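/- arXiv:2605.09930 — 4 statements merged into one kernel-verified Lean document; each statement's English description precedes it below -/
import Mathlib

section
/- For two agents with valuations v_1 and v_2 that are both monotone non-decreasing, or both monotone non-increasing (with v_1(∅) = v_2(∅) = 0), and any finite conflict graph G, there exists an allocation (A_1, A_2) that is both EF1 and maximal. -/
/-- A pair of disjoint independent sets such that every other vertex has a neighbour in both. -/
structure IsMaximalPair {α : Type*} (G : SimpleGraph α) (X Y : Finset α) : Prop where
  disjoint : Disjoint X Y
  indep_left : ∀ x ∈ X, ∀ y ∈ X, ¬ G.Adj x y
  indep_right : ∀ x ∈ Y, ∀ y ∈ Y, ¬ G.Adj x y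
  adj_left : ∀ o, o ∉ X → o ∉ Y → ∃ x ∈ X, G.Adj o x
  adj_right : ∀ o, o ∉ X → o ∉ Y → ∃ y ∈ Y, G.Adj o y

theorem IsMaximalPair.symm {α : Type*} {G : SimpleGraph α} {X Y : Finset α}
    (h : IsMaximalPair G X Y) : IsMaximalPair G Y X :=
  ⟨h.disjoint.symm, h.indep_right, h.indep_left, fun o hY hX => h.adj_right o hX hY,
    fun o hY hX => h.adj_left o hX hY⟩

/-- Greedy independent sets: processing the vertices of `W` in order of increasing `f`, every
rejected vertex has an accepted neighbour of no larger `f`-value. -/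
theorem exists_greedy_indep {α : Type*} [DecidableEq α] (G : SimpleGraph α) (f : α → ℕ)
    (W : Finset α) :
    ∃ C ⊆ W, (∀ x ∈ C, ∀ y ∈ C, ¬ G.Adj x y) ∧
      ∀ o ∈ W, o ∉ C → ∃ c ∈ C, G.Adj o c ∧ f c ≤ f o := by
  induction W using Finset.induction_on_max_value f with
  | empty => exact ⟨∅, by simp⟩
  | insert a s has hmax ih =>
    obtain ⟨C, hCs, hC, hdom⟩ := ih
    by_cases ha : ∃ c ∈ C, G.Adj a c
    · obtain ⟨c, hc, hac⟩ := ha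
      refine ⟨C, hCs.trans (Finset.subset_insert _ _), hC, fun o ho hoC => ?_⟩
      rcases Finset.mem_insert.1 ho with rfl | ho
      · exact ⟨c, hc, hac, hmax c (hCs hc)⟩
      · exact hdom o ho hoC
    · push Not at ha
      refine ⟨insert a C, Finset.insert_subset_insert _ hCs, fun x hx y hy hxy => ?_,
        fun o ho hoC => ?_⟩
      · rcases Finset.mem_insert.1 hx with rfl | hx' <;>
        rcases Finset.mem_insert.1 hy with rfl | hy'
        · exact G.loopless.irrefl _ hxy
        · exact ha y hy' hxy
        · exact ha x hx' hxy.symm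
        · exact hC x hx' y hy' hxy
      · rw [Finset.mem_insert, not_or] at hoC
        obtain ⟨c, hc, h⟩ := hdom o ((Finset.mem_insert.1 ho).resolve_left hoC.1) hoC.2
        exact ⟨c, Finset.mem_insert_of_mem hc, h⟩

/-- An independent set of largest value that is also maximal under inclusion. -/
theorem exists_indep_max_value {α : Type*} [Fintype α] [DecidableEq α] (G : SimpleGraph α)
    (u : Finset α → ℝ) (hu : Monotone u) :
    ∃ X : Finset α, (∀ x ∈ X, ∀ y ∈ X, ¬ G.Adj x y) ∧ (∀ o, o ∉ X → ∃ x ∈ X, G.Adj o x) ∧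
      ∀ Z : Finset α, (∀ x ∈ Z, ∀ y ∈ Z, ¬ G.Adj x y) → u Z ≤ u X := by
  classical
  let I : Finset (Finset α) := Finset.univ.filter fun Z => ∀ x ∈ Z, ∀ y ∈ Z, ¬ G.Adj x y
  obtain ⟨X₀, hX₀, hmax⟩ := I.exists_max_image u ⟨∅, by simp [I]⟩
  obtain ⟨X, hX, hcard⟩ := (I.filter fun Z => u X₀ ≤ u Z).exists_max_image Finset.card
    ⟨X₀, by simp [hX₀]⟩
  simp only [I, Finset.mem_filter, Finset.mem_univ, true_and] at hX hX₀ hmax hcard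
  refine ⟨X, hX.1, fun o ho => ?_, fun Z hZ => (hmax Z hZ).trans hX.2⟩
  by_contra! hno
  have := hcard (insert o X) ⟨fun x hx y hy hxy => ?_,
    hX.2.trans (hu (Finset.subset_insert _ _))⟩
  · rw [Finset.card_insert_of_notMem ho] at this
    omega
  · rcases Finset.mem_insert.1 hx with rfl | hx' <;>
        rcases Finset.mem_insert.1 hy with rfl | hy'
    · exact G.loopless.irrefl _ hxy
    · exact hno y hy' hxy
    · exact hno x hx' hxy.symm
    · exact hX.1 x hx' y hy' hxy

/-- Between a maximal independent set `X` held by the first agent and the same set held by the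
second, there is a sequence of maximal pairs in which each step takes from the first bundle only
the vertex being transferred and adds to the second bundle only that vertex. -/
theorem exists_maximalPair_sequence {α : Type*} [Fintype α] [DecidableEq α] (G : SimpleGraph α)
    (X : Finset α) (hX : ∀ x ∈ X, ∀ y ∈ X, ¬ G.Adj x y)
    (hdom : ∀ o, o ∉ X → ∃ x ∈ X, G.Adj o x) :
    ∃ (n : ℕ) (P Q : ℕ → Finset α), (∀ t ≤ n, IsMaximalPair G (P t) (Q t)) ∧
      X ⊆ P 0 ∧ X ⊆ Q n ∧
      ∀ t < n, ∃ a, (P t).erase a ⊆ P (t + 1) ∧ (Q (t + 1)).erase a ⊆ Q t := by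
  classical
  let e := Fintype.equivFin α
  let n := Fintype.card α
  let r : α → ℕ := fun x => e x
  have hr : ∀ x, r x < n := fun x => (e x).2
  let N : α → Finset α := fun o => X.filter (G.Adj o)
  let f : α → ℕ := fun o => (N o).sup fun x => r x + 1
  let g : α → ℕ := fun o => (N o).sup fun x => n - r x
  have hf : ∀ o t, f o ≤ t ↔ ∀ x ∈ X, G.Adj o x → r x < t := by
    intro o t
    simp [f, N, Finset.sup_le_iff]
  have hg : ∀ o t, t ≤ n → (g o ≤ n - t ↔ ∀ x ∈ X, G.Adj o x → t ≤ r x) := by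
    intro o t ht
    simp only [g, N, Finset.sup_le_iff, Finset.mem_filter, and_imp]
    refine forall₃_congr fun x _ _ => ?_
    have := hr x
    omega
  obtain ⟨C, hCX, hC, hCdom⟩ := exists_greedy_indep G f Xᶜ
  obtain ⟨D, hDX, hD, hDdom⟩ := exists_greedy_indep G g Xᶜ
  have hCX' : ∀ c ∈ C, c ∉ X := fun c hc => Finset.mem_compl.1 (hCX hc)
  have hDX' : ∀ c ∈ D, c ∉ X := fun c hc => Finset.mem_compl.1 (hDX hc)
  let P : ℕ → Finset α := fun t =>
    X.filter (fun x => t ≤ r x) ∪ C.filter fun c => ∀ x ∈ X, G.Adj c x → r x < t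
  let Q : ℕ → Finset α := fun t =>
    X.filter (fun x => r x < t) ∪ D.filter fun c => ∀ x ∈ X, G.Adj c x → t ≤ r x
  have hP : ∀ t o, o ∈ P t ↔
      (o ∈ X ∧ t ≤ r o) ∨ (o ∈ C ∧ ∀ x ∈ X, G.Adj o x → r x < t) := by
    intro t o; simp [P]
  have hQ : ∀ t o, o ∈ Q t ↔
      (o ∈ X ∧ r o < t) ∨ (o ∈ D ∧ ∀ x ∈ X, G.Adj o x → t ≤ r x) := by
    intro t o; simp [Q]
  refine ⟨n, P, Q, fun t ht => ⟨?_, ?_, ?_, ?_, ?_⟩, fun x hx => ?_, fun x hx => ?_,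
    fun t ht => ⟨e.symm ⟨t, ht⟩, fun x hx => ?_, fun x hx => ?_⟩⟩
  · rw [Finset.disjoint_left]
    intro o ho ho'
    rw [hP] at ho
    rw [hQ] at ho'
    rcases ho with ⟨h1, h2⟩ | ⟨h1, h2⟩ <;> rcases ho' with ⟨h3, h4⟩ | ⟨h3, h4⟩
    · omega
    · exact hDX' o h3 h1
    · exact hCX' o h1 h3
    · obtain ⟨x, hx, hox⟩ := hdom o (hCX' o h1)
      exact absurd (h2 x hx hox) (not_lt.2 (h4 x hx hox))
  · intro x hx y hy hxy
    rw [hP] at hx hy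
    rcases hx with ⟨h1, h2⟩ | ⟨h1, h2⟩ <;> rcases hy with ⟨h3, h4⟩ | ⟨h3, h4⟩
    · exact hX x h1 y h3 hxy
    · exact absurd (h4 x h1 hxy.symm) (not_lt.2 h2)
    · exact absurd (h2 y h3 hxy) (not_lt.2 h4)
    · exact hC x h1 y h3 hxy
  · intro x hx y hy hxy
    rw [hQ] at hx hy
    rcases hx with ⟨h1, h2⟩ | ⟨h1, h2⟩ <;> rcases hy with ⟨h3, h4⟩ | ⟨h3, h4⟩
    · exact hX x h1 y h3 hxy
    · exact absurd (h4 x h1 hxy.symm) (not_le.2 h2)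
    · exact absurd (h2 y h3 hxy) (not_le.2 h4)
    · exact hD x h1 y h3 hxy
  · intro o hoP hoQ
    rw [hP, not_or] at hoP
    rw [hQ, not_or] at hoQ
    by_cases h : ∀ x ∈ X, G.Adj o x → r x < t
    · have hoX : o ∉ X := fun hoX => by
        have h1 := hoP.1
        have h2 := hoQ.1
        simp only [hoX, true_and] at h1 h2
        omega
      obtain ⟨c, hc, hoc, hfc⟩ := hCdom o (Finset.mem_compl.2 hoX) fun hoC => hoP.2 ⟨hoC, h⟩
      exact ⟨c, (hP t c).2 (Or.inr ⟨hc, (hf c t).1 (hfc.trans ((hf o t).2 h))⟩), hoc⟩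
    · push Not at h
      obtain ⟨x, hx, hox, htx⟩ := h
      exact ⟨x, (hP t x).2 (Or.inl ⟨hx, htx⟩), hox⟩
  · intro o hoP hoQ
    rw [hP, not_or] at hoP
    rw [hQ, not_or] at hoQ
    by_cases h : ∀ x ∈ X, G.Adj o x → t ≤ r x
    · have hoX : o ∉ X := fun hoX => by
        have h1 := hoP.1
        have h2 := hoQ.1
        simp only [hoX, true_and] at h1 h2
        omega
      obtain ⟨c, hc, hoc, hgc⟩ := hDdom o (Finset.mem_compl.2 hoX) fun hoD => hoQ.2 ⟨hoD, h⟩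
      exact ⟨c, (hQ t c).2 (Or.inr ⟨hc, (hg c t ht).1 (hgc.trans ((hg o t ht).2 h))⟩), hoc⟩
    · push Not at h
      obtain ⟨x, hx, hox, htx⟩ := h
      exact ⟨x, (hQ t x).2 (Or.inl ⟨hx, htx⟩), hox⟩
  · exact (hP 0 x).2 (Or.inl ⟨hx, Nat.zero_le _⟩)
  · exact (hQ n x).2 (Or.inl ⟨hx, hr x⟩)
  · rw [Finset.mem_erase, hP] at hx
    obtain ⟨hne, ⟨h1, h2⟩ | ⟨h1, h2⟩⟩ := hx
    · have hrx : r x ≠ t := fun h => hne (e.injective (Fin.ext (by simpa [r] using h)))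
      exact (hP _ x).2 (Or.inl ⟨h1, by omega⟩)
    · exact (hP _ x).2 (Or.inr ⟨h1, fun y hy hxy => (h2 y hy hxy).trans (Nat.lt_succ_self t)⟩)
  · rw [Finset.mem_erase, hQ] at hx
    obtain ⟨hne, ⟨h1, h2⟩ | ⟨h1, h2⟩⟩ := hx
    · have hrx : r x ≠ t := fun h => hne (e.injective (Fin.ext (by simpa [r] using h)))
      exact (hQ _ x).2 (Or.inl ⟨h1, by omega⟩)
    · exact (hQ _ x).2 (Or.inr ⟨h1, fun y hy hxy => (Nat.le_succ t).trans (h2 y hy hxy)⟩)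

/-- A monotone set function admits a maximal pair in which neither bundle exceeds the other by more
than the effect of one vertex. -/
theorem exists_balanced_maximalPair {α : Type*} [Fintype α] [DecidableEq α] (G : SimpleGraph α)
    (u : Finset α → ℝ) (hu : Monotone u) :
    ∃ X Y : Finset α, IsMaximalPair G X Y ∧
      (∃ T ⊆ X, T.card ≤ 1 ∧ u (X \ T) ≤ u Y) ∧ ∃ T ⊆ Y, T.card ≤ 1 ∧ u (Y \ T) ≤ u X := by
  classical
  have erase_le : ∀ (X Y : Finset α) (a : α), u (X.erase a) ≤ u Y →
      ∃ T ⊆ X, T.card ≤ 1 ∧ u (X \ T) ≤ u Y := by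
    intro X Y a h
    refine ⟨X ∩ {a}, Finset.inter_subset_left,
      (Finset.card_le_card Finset.inter_subset_right).trans (by simp), ?_⟩
    rwa [Finset.sdiff_inter_self_left, Finset.sdiff_singleton_eq_erase]
  have of_le : ∀ X Y : Finset α, u X ≤ u Y → ∃ T ⊆ X, T.card ≤ 1 ∧ u (X \ T) ≤ u Y :=
    fun X Y h => ⟨∅, by simp, by simp, by simpa using h⟩
  obtain ⟨X, hX, hdom, hbest⟩ := exists_indep_max_value G u hu
  obtain ⟨n, P, Q, hPQ, hX0, hXn, hstep⟩ := exists_maximalPair_sequence G X hX hdom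
  have hn : u (P n) ≤ u (Q n) := (hbest _ (hPQ n le_rfl).indep_left).trans (hu hXn)
  have h0 : u (Q 0) ≤ u (P 0) := (hbest _ (hPQ 0 n.zero_le).indep_right).trans (hu hX0)
  have hex : ∃ t, u (P t) ≤ u (Q t) := ⟨n, hn⟩
  have htn : Nat.find hex ≤ n := Nat.find_min' hex hn
  have hlast := Nat.find_spec hex
  have hbefore := fun s => Nat.find_min hex (m := s)
  generalize Nat.find hex = t at htn hlast hbefore
  cases t with
  | zero => exact ⟨P 0, Q 0, hPQ 0 htn, of_le _ _ hlast, of_le _ _ h0⟩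
  | succ t =>
    have ht := (not_le.1 (hbefore t t.lt_succ_self)).le
    obtain ⟨a, haP, haQ⟩ := hstep t htn
    rcases le_total (u ((P t).erase a)) (u (Q t)) with h | h
    · exact ⟨P t, Q t, hPQ t (Nat.le_of_succ_le htn), erase_le _ _ a h, of_le _ _ ht⟩
    · exact ⟨P (t + 1), Q (t + 1), hPQ _ htn, of_le _ _ hlast,
        erase_le _ _ a ((hu haQ).trans (h.trans (hu haP)))⟩


/-- for two agents whose valuations are both monotone non-decreasing or
both monotone non-increasing, and any conflict graph, an EF1 and maximal allocation exists. -/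
theorem stmt_5 {α : Type*} [Fintype α] [DecidableEq α] (G : SimpleGraph α)
    (v : Fin 2 → Finset α → ℝ)
    (hzero : ∀ i, v i ∅ = 0)
    (hmono : (∀ i, ∀ S T : Finset α, S ⊆ T → v i S ≤ v i T) ∨
             (∀ i, ∀ S T : Finset α, S ⊆ T → v i T ≤ v i S)) :
    ∃ A : Fin 2 → Finset α,
      (∀ i j : Fin 2, i ≠ j → Disjoint (A i) (A j)) ∧
      (∀ i : Fin 2, ∀ x ∈ A i, ∀ y ∈ A i, ¬ G.Adj x y) ∧
      (∀ o : α, (∀ i : Fin 2, o ∉ A i) → ∀ i : Fin 2, ∃ x ∈ A i, G.Adj o x) ∧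
      (∀ i j : Fin 2, ∃ S : Finset α, S ⊆ A i ∪ A j ∧ S.card ≤ 1 ∧
        v i (A i \ S) ≥ v i (A j \ S)) := by
  have key : ∃ X Y : Finset α, IsMaximalPair G X Y ∧
      (∃ T ⊆ X ∪ Y, T.card ≤ 1 ∧ v 0 (Y \ T) ≤ v 0 (X \ T)) ∧
      ∃ T ⊆ X ∪ Y, T.card ≤ 1 ∧ v 0 (X \ T) ≤ v 0 (Y \ T) := by
    rcases hmono with h | h
    · obtain ⟨X, Y, hXY, ⟨T, hT, hTc, hTv⟩, T', hT', hTc', hTv'⟩ :=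
        exists_balanced_maximalPair G (v 0) fun S T hST => h 0 S T hST
      refine ⟨X, Y, hXY, ⟨T', hT'.trans Finset.subset_union_right, hTc', ?_⟩,
        T, hT.trans Finset.subset_union_left, hTc, ?_⟩
      · rwa [Finset.sdiff_eq_self_of_disjoint (hXY.disjoint.mono_right hT')]
      · rwa [Finset.sdiff_eq_self_of_disjoint (hXY.disjoint.symm.mono_right hT)]
    · obtain ⟨X, Y, hXY, ⟨T, hT, hTc, hTv⟩, T', hT', hTc', hTv'⟩ :=
        exists_balanced_maximalPair G (fun S => - v 0 S) fun S T hST => neg_le_neg (h 0 S T hST)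
      refine ⟨X, Y, hXY, ⟨T, hT.trans Finset.subset_union_left, hTc, ?_⟩,
        T', hT'.trans Finset.subset_union_right, hTc', ?_⟩
      · rw [Finset.sdiff_eq_self_of_disjoint (hXY.disjoint.symm.mono_right hT)]
        exact neg_le_neg_iff.1 hTv
      · rw [Finset.sdiff_eq_self_of_disjoint (hXY.disjoint.mono_right hT')]
        exact neg_le_neg_iff.1 hTv'
  have choose_right : ∃ X Y : Finset α, IsMaximalPair G X Y ∧
      (∃ T ⊆ X ∪ Y, T.card ≤ 1 ∧ v 0 (Y \ T) ≤ v 0 (X \ T)) ∧ v 1 X ≤ v 1 Y := by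
    obtain ⟨X, Y, hXY, h1, T, hT, h2⟩ := key
    rcases le_total (v 1 X) (v 1 Y) with h | h
    · exact ⟨X, Y, hXY, h1, h⟩
    · exact ⟨Y, X, hXY.symm, ⟨T, Finset.union_comm X Y ▸ hT, h2⟩, h⟩
  obtain ⟨X, Y, hXY, ⟨T, hT, hTc, hTv⟩, h1⟩ := choose_right
  refine ⟨![X, Y], ?_, ?_, ?_, ?_⟩
  · simpa [Fin.forall_fin_two] using ⟨hXY.disjoint, hXY.disjoint.symm⟩
  · exact Fin.forall_fin_two.2 ⟨hXY.indep_left, hXY.indep_right⟩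
  · intro o ho
    exact Fin.forall_fin_two.2 ⟨hXY.adj_left o (ho 0) (ho 1), hXY.adj_right o (ho 0) (ho 1)⟩
  · refine Fin.forall_fin_two.2 ⟨Fin.forall_fin_two.2 ⟨?_, ?_⟩, Fin.forall_fin_two.2 ⟨?_, ?_⟩⟩
    · exact ⟨∅, by simp⟩
    · exact ⟨T, hT, hTc, hTv⟩
    · exact ⟨∅, by simpa using h1⟩
    · exact ⟨∅, by simp⟩
end

section
/- For two agents who have the same monotone non-decreasing valuation v (with v(∅) = 0) and any finite conflict graph G, there exists an allocation (A_1, A_2) that is both EF1 and maximal. -/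
section MaximalIndependent

variable {α : Type*} (G : SimpleGraph α)

/-- `Y` is inclusion-maximal among the subsets of `W` that are independent in `G`. -/
def IsMaxIndepIn (W Y : Finset α) : Prop :=
  Y ⊆ W ∧ (∀ x ∈ Y, ∀ y ∈ Y, ¬ G.Adj x y) ∧ ∀ o ∈ W, o ∉ Y → ∃ x ∈ Y, G.Adj o x

variable {G}

theorem exists_isMaxIndepIn_superset [DecidableEq α] {W X : Finset α} (hXW : X ⊆ W)
    (hX : ∀ x ∈ X, ∀ y ∈ X, ¬ G.Adj x y) : ∃ Y, X ⊆ Y ∧ IsMaxIndepIn G W Y := by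
  classical
  obtain ⟨Y, hY, hmax⟩ := Finset.exists_max_image
    (W.powerset.filter fun Y => X ⊆ Y ∧ ∀ x ∈ Y, ∀ y ∈ Y, ¬ G.Adj x y) Finset.card
    ⟨X, by simpa [hXW] using hX⟩
  simp only [Finset.mem_filter, Finset.mem_powerset] at hY hmax
  obtain ⟨hYW, hXY, hind⟩ := hY
  refine ⟨Y, hXY, hYW, hind, fun o ho hoY => ?_⟩
  by_contra! hno
  have hle := hmax (insert o Y) ⟨Finset.insert_subset ho hYW,
    hXY.trans (Finset.subset_insert _ _), by
      intro x hx y hy hxy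
      rw [Finset.mem_insert] at hx hy
      rcases hx with rfl | hx <;> rcases hy with rfl | hy
      · exact G.loopless.irrefl _ hxy
      · exact hno _ hy hxy
      · exact hno _ hx hxy.symm
      · exact hind _ hx _ hy hxy⟩
  rw [Finset.card_insert_of_notMem hoY] at hle
  omega

/-- Maximal independent subsets of an increasing sequence of sets can be chosen increasing. -/
theorem exists_monotone_isMaxIndepIn [DecidableEq α] {W : ℕ → Finset α} (hW : Monotone W) :
    ∃ I : ℕ → Finset α, Monotone I ∧ ∀ n, IsMaxIndepIn G (W n) (I n) := by
  obtain ⟨I₀, -, hI₀⟩ := exists_isMaxIndepIn_superset (G := G) (Finset.empty_subset (W 0)) (by simp)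
  have ext : ∀ n (Y : {Y // IsMaxIndepIn G (W n) Y}),
      ∃ Z : {Z // IsMaxIndepIn G (W (n + 1)) Z}, Y.1 ⊆ Z.1 := fun n Y => by
    obtain ⟨Z, hYZ, hZ⟩ :=
      exists_isMaxIndepIn_superset (Y.2.1.trans (hW n.le_succ)) Y.2.2.1
    exact ⟨⟨Z, hZ⟩, hYZ⟩
  choose next hnext using ext
  let I : ∀ n, {Y // IsMaxIndepIn G (W n) Y} := fun n => Nat.rec ⟨I₀, hI₀⟩ next n
  exact ⟨fun n => (I n).1, monotone_nat_of_le_succ fun n => hnext n (I n), fun n => (I n).2⟩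

end MaximalIndependent

section Splitting

variable {α : Type*} [Fintype α] [DecidableEq α] (G : SimpleGraph α)

open Classical in
/-- The vertices outside `B` with no neighbour in `C`. -/
noncomputable def nonNeighbors (B C : Finset α) : Finset α :=
  Finset.univ.filter fun o => o ∉ B ∧ ∀ y ∈ C, ¬ G.Adj o y

variable {G} {B C I : Finset α}

theorem mem_nonNeighbors {o : α} :
    o ∈ nonNeighbors G B C ↔ o ∉ B ∧ ∀ y ∈ C, ¬ G.Adj o y := by
  simp [nonNeighbors]

theorem nonNeighbors_anti {D : Finset α} (h : C ⊆ D) :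
    nonNeighbors G B D ⊆ nonNeighbors G B C := fun _ ho =>
  mem_nonNeighbors.2 ⟨(mem_nonNeighbors.1 ho).1, fun y hy => (mem_nonNeighbors.1 ho).2 y (h hy)⟩

theorem IsMaxIndepIn.union_indep (hB : ∀ x ∈ B, ∀ y ∈ B, ¬ G.Adj x y) (hC : C ⊆ B)
    (hI : IsMaxIndepIn G (nonNeighbors G B C) I) :
    ∀ x ∈ C ∪ I, ∀ y ∈ C ∪ I, ¬ G.Adj x y := by
  intro x hx y hy hxy
  rcases Finset.mem_union.1 hx with hx | hx <;> rcases Finset.mem_union.1 hy with hy | hy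
  · exact hB _ (hC hx) _ (hC hy) hxy
  · exact (mem_nonNeighbors.1 (hI.1 hy)).2 _ hx hxy.symm
  · exact (mem_nonNeighbors.1 (hI.1 hx)).2 _ hy hxy
  · exact hI.2.1 _ hx _ hy hxy

theorem IsMaxIndepIn.exists_adj_union (hI : IsMaxIndepIn G (nonNeighbors G B C) I) {o : α}
    (hoB : o ∉ B) (hoI : o ∉ I) : ∃ x ∈ C ∪ I, G.Adj o x := by
  by_cases h : ∃ y ∈ C, G.Adj o y
  · obtain ⟨y, hy, hoy⟩ := h
    exact ⟨y, Finset.mem_union_left _ hy, hoy⟩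
  · push Not at h
    obtain ⟨x, hx, hox⟩ := hI.2.2 o (mem_nonNeighbors.2 ⟨hoB, h⟩) hoI
    exact ⟨x, Finset.mem_union_right _ hx, hox⟩

end Splitting

section EnvyFree

variable {α : Type*} [DecidableEq α] (v : Finset α → ℝ)

/-- An agent with valuation `v` holding `A` does not envy `B` by more than one item. -/
def EnvyFreeUpToOne (A B : Finset α) : Prop :=
  ∃ S : Finset α, S ⊆ A ∪ B ∧ S.card ≤ 1 ∧ v (A \ S) ≥ v (B \ S)

variable {v} {A B : Finset α}

theorem envyFreeUpToOne_of_le (h : v B ≤ v A) : EnvyFreeUpToOne v A B :=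
  ⟨∅, by simp, by simp, by simpa using h⟩

theorem envyFreeUpToOne_of_sdiff_singleton_le (hAB : Disjoint A B) (b : α)
    (h : v (B \ {b}) ≤ v A) : EnvyFreeUpToOne v A B := by
  by_cases hb : b ∈ B
  · have hbA : b ∉ A := Finset.disjoint_right.1 hAB hb
    refine ⟨{b}, by simp [hb], by simp, ?_⟩
    rwa [Finset.sdiff_eq_self_of_disjoint (Finset.disjoint_singleton_right.2 hbA)]
  · rw [Finset.sdiff_eq_self_of_disjoint (Finset.disjoint_singleton_right.2 hb)] at h
    exact envyFreeUpToOne_of_le h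

/-- A discrete intermediate value argument: if one item at a time enters `A` or leaves `B`,
then some pair on the way is envy-free up to one item in both directions. -/
theorem exists_envyFreeUpToOne_of_chain (hmono : ∀ S T : Finset α, S ⊆ T → v S ≤ v T)
    {A B : ℕ → Finset α} {k : ℕ} (hdisj : ∀ i ≤ k, Disjoint (A i) (B i))
    (hstep : ∀ i < k, ∃ b, A (i + 1) \ {b} ⊆ A i ∧ B i \ {b} ⊆ B (i + 1))
    (h₀ : v (A 0) ≤ v (B 0)) (hk : v (B k) ≤ v (A k)) :
    ∃ i ≤ k, EnvyFreeUpToOne v (A i) (B i) ∧ EnvyFreeUpToOne v (B i) (A i) := by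
  by_contra! hno
  have hle : ∀ i ≤ k, v (A i) ≤ v (B i) := by
    intro i
    induction i with
    | zero => exact fun _ => h₀
    | succ i ih =>
      intro hi
      have hAB := ih (by omega)
      obtain ⟨b, hA, hB⟩ := hstep i (by omega)
      by_contra! hlt
      have h₁ : v (A i) < v (B i \ {b}) := by
        by_contra! h
        exact hno i (by omega)
          (envyFreeUpToOne_of_sdiff_singleton_le (hdisj i (by omega)) b h)
          (envyFreeUpToOne_of_le hAB)
      have h₂ : v (B (i + 1)) < v (A (i + 1) \ {b}) := by
        by_contra! h
        exact hno (i + 1) hi (envyFreeUpToOne_of_le hlt.le)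
          (envyFreeUpToOne_of_sdiff_singleton_le (hdisj (i + 1) hi).symm b h)
      linarith [hmono _ _ hA, hmono _ _ hB]
  exact hno k le_rfl (envyFreeUpToOne_of_le hk) (envyFreeUpToOne_of_le (hle k le_rfl))

end EnvyFree

/-- for two agents with the same monotone non-decreasing valuation and any
conflict graph, an EF1 and maximal allocation exists. -/
theorem stmt_6 {α : Type*} [Fintype α] [DecidableEq α] (G : SimpleGraph α)
    (v : Finset α → ℝ) (hzero : v ∅ = 0)
    (hmono : ∀ S T : Finset α, S ⊆ T → v S ≤ v T) :
    ∃ A : Fin 2 → Finset α,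
      (∀ i j : Fin 2, i ≠ j → Disjoint (A i) (A j)) ∧
      (∀ i : Fin 2, ∀ x ∈ A i, ∀ y ∈ A i, ¬ G.Adj x y) ∧
      (∀ o : α, (∀ i : Fin 2, o ∉ A i) → ∀ i : Fin 2, ∃ x ∈ A i, G.Adj o x) ∧
      (∀ i j : Fin 2, ∃ S : Finset α, S ⊆ A i ∪ A j ∧ S.card ≤ 1 ∧
        v (A i \ S) ≥ v (A j \ S)) := by
  classical
  obtain ⟨B₀, hB₀, hbest⟩ := Finset.exists_max_image
    (Finset.univ.filter fun Y : Finset α => ∀ x ∈ Y, ∀ y ∈ Y, ¬ G.Adj x y) v ⟨∅, by simp⟩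
  simp only [Finset.mem_filter, Finset.mem_univ, true_and] at hB₀ hbest
  obtain ⟨B, hB₀B, -, hB, hBmax⟩ :=
    exists_isMaxIndepIn_superset (G := G) (Finset.subset_univ B₀) hB₀
  replace hbest : ∀ Y : Finset α, (∀ x ∈ Y, ∀ y ∈ Y, ¬ G.Adj x y) → v Y ≤ v B :=
    fun Y hY => (hbest Y hY).trans (hmono _ _ hB₀B)
  let e := Fintype.equivFin α
  let k := Fintype.card α
  let T : ℕ → Finset α := fun i => B.filter fun x => (e x : ℕ) < i
  have hTB : ∀ i, T i ⊆ B := fun i => Finset.filter_subset _ _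
  have hTmono : Monotone T := fun i j hij x hx => by
    simp only [T, Finset.mem_filter] at hx ⊢
    exact ⟨hx.1, by omega⟩
  have hT₀ : T 0 = ∅ := by simp [T]
  have hTk : T k = B := Finset.filter_true_of_mem fun x _ => (e x).isLt
  have hTstep : ∀ i < k, ∃ b, T (i + 1) \ {b} ⊆ T i := by
    refine fun i hi => ⟨e.symm ⟨i, hi⟩, fun x hx => ?_⟩
    simp only [T, Finset.mem_sdiff, Finset.mem_filter, Finset.mem_singleton] at hx ⊢
    have hne : (e x : ℕ) ≠ i := fun h => hx.2 (e.eq_symm_apply.2 (Fin.ext h))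
    exact ⟨hx.1.1, by omega⟩
  obtain ⟨I', hI'mono, hI'⟩ := exists_monotone_isMaxIndepIn (G := G)
    (W := fun n => nonNeighbors G B (T (k - n)))
    fun m n hmn => nonNeighbors_anti (hTmono (by omega))
  obtain ⟨J, hJmono, hJ⟩ := exists_monotone_isMaxIndepIn (G := G)
    (W := fun n => nonNeighbors G B (B \ T n))
    fun m n hmn => nonNeighbors_anti (Finset.sdiff_subset_sdiff le_rfl (hTmono hmn))
  let I : ℕ → Finset α := fun i => I' (k - i)
  have hI : ∀ i ≤ k, IsMaxIndepIn G (nonNeighbors G B (T i)) (I i) := fun i hi => by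
    have h := hI' (k - i)
    rwa [Nat.sub_sub_self hi] at h
  have hdisj : ∀ i ≤ k, Disjoint (T i ∪ I i) ((B \ T i) ∪ J i) := by
    intro i hi
    refine Finset.disjoint_left.2 fun x hx hx' => ?_
    rcases Finset.mem_union.1 hx with hx | hx <;> rcases Finset.mem_union.1 hx' with hx' | hx'
    · exact (Finset.mem_sdiff.1 hx').2 hx
    · exact (mem_nonNeighbors.1 ((hJ i).1 hx')).1 (hTB i hx)
    · exact (mem_nonNeighbors.1 ((hI i hi).1 hx)).1 (Finset.mem_sdiff.1 hx').1
    · have h₁ := mem_nonNeighbors.1 ((hI i hi).1 hx)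
      have h₂ := mem_nonNeighbors.1 ((hJ i).1 hx')
      obtain ⟨y, hy, hxy⟩ := hBmax x (Finset.mem_univ x) h₁.1
      by_cases hyT : y ∈ T i
      · exact h₁.2 y hyT hxy
      · exact h₂.2 y (Finset.mem_sdiff.2 ⟨hy, hyT⟩) hxy
  have hindA : ∀ i ≤ k, ∀ x ∈ T i ∪ I i, ∀ y ∈ T i ∪ I i, ¬ G.Adj x y :=
    fun i hi => (hI i hi).union_indep hB (hTB i)
  have hindB : ∀ i, ∀ x ∈ (B \ T i) ∪ J i, ∀ y ∈ (B \ T i) ∪ J i, ¬ G.Adj x y :=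
    fun i => (hJ i).union_indep hB Finset.sdiff_subset
  obtain ⟨i, hi, hAB, hBA⟩ := exists_envyFreeUpToOne_of_chain hmono
    (A := fun i => T i ∪ I i) (B := fun i => (B \ T i) ∪ J i) hdisj
    (fun i hi => by
      obtain ⟨b, hb⟩ := hTstep i hi
      have hIsub : I (i + 1) ⊆ I i := hI'mono (by omega)
      have hJsub : J i ⊆ J (i + 1) := hJmono (by omega)
      refine ⟨b, fun x hx => ?_, fun x hx => ?_⟩ <;> grind)
    ((hbest _ (hindA 0 (Nat.zero_le k))).trans (hmono _ _ (by simp [hT₀])))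
    ((hbest _ (hindB k)).trans (hmono _ _ (by simp [hTk])))
  have hself : ∀ X : Finset α, EnvyFreeUpToOne v X X := fun X => envyFreeUpToOne_of_le le_rfl
  refine ⟨![T i ∪ I i, (B \ T i) ∪ J i], ?_, ?_, ?_, ?_⟩
  · rw [Fin.forall_fin_two]
    simp only [Fin.forall_fin_two]
    exact ⟨⟨fun h => (h rfl).elim, fun _ => hdisj i hi⟩,
      ⟨fun _ => (hdisj i hi).symm, fun h => (h rfl).elim⟩⟩
  · exact Fin.forall_fin_two.2 ⟨hindA i hi, hindB i⟩
  · intro o ho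
    have hoA : o ∉ T i ∪ I i := ho 0
    have hoB : o ∉ (B \ T i) ∪ J i := ho 1
    simp only [Finset.mem_union, Finset.mem_sdiff, not_or, not_and, not_not] at hoA hoB
    have hnB : o ∉ B := fun h => hoA.1 (hoB.1 h)
    exact Fin.forall_fin_two.2
      ⟨(hI i hi).exists_adj_union hnB hoA.2, (hJ i).exists_adj_union hnB hoB.2⟩
  · exact Fin.forall_fin_two.2 ⟨Fin.forall_fin_two.2 ⟨hself _, hAB⟩,
      Fin.forall_fin_two.2 ⟨hBA, hself _⟩⟩
end

section
/- For every integer n ≥ 3, every set of items o_1,...,o_m whose conflict graph is the path with edges {o_i, o_{i+1}} for i = 1,...,m−1, and every additive (possibly non-monotone) valuation v shared by all n agents, there exists a complete (and therefore maximal) allocation (A_1,...,A_n) that is EF[1,1]. -/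
open Finset

/-- The field with four elements. -/
abbrev F4 := QuadraticAlgebra (ZMod 2) 1 1

/-- A primitive cube root of unity in `F4`. -/
def omega4 : F4 := ⟨0, 1⟩

theorem F4.add_self (x : F4) : x + x = 0 := by
  ext <;> simp [CharTwo.add_self_eq_zero]

theorem sum_perm_omega4 (d : Fin 3 → Fin 3) :
    ∑ σ : Equiv.Perm (Fin 3), ∏ i, (omega4 ^ (σ i).val) ^ (d i).val =
      if Function.Bijective d then 1 else 0 := by
  revert d
  decide

/-- The number of edges at a vertex that choose it, where `h` records whether the edge on the left
chooses the vertex and `c` whether `h` changes at the vertex. -/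
def outdeg (h c : ZMod 2) : Fin 3 := if c = 0 then 1 else if h = 1 then 2 else 0

theorem bijective_outdeg_iff (h c : Fin 3 → ZMod 2) :
    Function.Bijective (fun i => outdeg (h i) (c i)) ↔
      ∑ i, c i = 0 ∧ ∑ i, c i * h i + (c 0 * c 1 + c 0 * c 2 + c 1 * c 2) = 0 ∧
        ¬ ∀ i, c i = 0 := by
  revert h c
  decide

/-- The state to the left of `v`, starting from `1` and changing according to `c`. -/
def height {N : ℕ} (c : Fin N → ZMod 2) (v : ℕ) : ZMod 2 :=
  1 + ∑ u : Fin N, if u.val < v then c u else 0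

theorem height_snoc {N : ℕ} (c : Fin N → ZMod 2) (a : ZMod 2) {v : ℕ} (hv : v ≤ N) :
    height (Fin.snoc c a : Fin (N + 1) → ZMod 2) v = height c v := by
  simp [height, Fin.sum_univ_castSucc, hv.not_gt]

theorem height_self {N : ℕ} (c : Fin N → ZMod 2) : height c N = 1 + ∑ u, c u := by
  simp [height]

theorem height_snoc_succ {N : ℕ} (c : Fin N → ZMod 2) (a : ZMod 2) :
    height (Fin.snoc c a : Fin (N + 1) → ZMod 2) (N + 1) = height c N + a := by
  simp [height_self, Fin.sum_univ_castSucc, add_assoc]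

theorem sum_pi_succ {R : Type*} [AddCommMonoid R] {N : ℕ} (f : (Fin (N + 1) → ZMod 2) → R) :
    ∑ c, f c = ∑ c : Fin N → ZMod 2, (f (Fin.snoc c 0) + f (Fin.snoc c 1)) := by
  rw [← (Fin.snocEquiv fun _ => ZMod 2).sum_comp, Fintype.sum_prod_type_right]
  refine sum_congr rfl fun c _ => ?_
  exact Fin.sum_univ_two (fun a : Fin 2 => f (Fin.snoc c a))

theorem sum_prod_pow_outdeg {R : Type*} [CommRing R] (x y : ℕ → R) (hy0 : y 0 = 0)
    (hy : ∀ v, y (v + 1) = x v) (N : ℕ) :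
    (∑ c : Fin N → ZMod 2, if height c N = 1 then
        ∏ v : Fin N, x v ^ (outdeg (height c v) (c v)).val else 0) =
      ∏ v ∈ range N, (x v + y v) ∧
    (∑ c : Fin N → ZMod 2, if height c N = 0 then
        ∏ v : Fin N, x v ^ (outdeg (height c v) (c v)).val else 0) =
      y N * ∏ v ∈ range N, (x v + y v) := by
  induction N with
  | zero => simp [height, hy0]
  | succ N ih =>
    have key (b : ZMod 2) : (∑ c : Fin (N + 1) → ZMod 2, if height c (N + 1) = b then
        ∏ v : Fin (N + 1), x v ^ (outdeg (height c v) (c v)).val else 0) =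
        (∑ c : Fin N → ZMod 2, if height c N = b then
          ∏ v : Fin N, x v ^ (outdeg (height c v) (c v)).val else 0) * x N +
        (∑ c : Fin N → ZMod 2, if height c N = b + 1 then
          ∏ v : Fin N, x v ^ (outdeg (height c v) (c v)).val else 0) *
            x N ^ (outdeg (b + 1) 1).val := by
      rw [sum_pi_succ, sum_mul, sum_mul, ← sum_add_distrib]
      refine sum_congr rfl fun c _ => ?_
      have h1 : height c N + 1 = b ↔ height c N = b + 1 := by
        generalize height c N = t
        revert t b
        decide
      have h2 : (outdeg (height c N) 0).val = 1 := by simp [outdeg]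
      simp only [height_snoc_succ, add_zero, h1, Fin.prod_univ_castSucc, Fin.snoc_castSucc,
        Fin.snoc_last, Fin.val_castSucc, Fin.val_last, height_snoc _ _ le_rfl, h2, pow_one,
        height_snoc _ _ (Fin.is_lt _).le, ite_mul, zero_mul]
      congr 1
      split_ifs with h
      · rw [h]
      · rfl
    have e1 := key 1
    have e0 := key 0
    have d1 : (outdeg (1 + 1) 1).val = 0 := by decide
    have d0 : (outdeg (0 + 1) 1).val = 2 := by decide
    rw [d1, show (1 + 1 : ZMod 2) = 0 by decide, ih.1, ih.2] at e1
    rw [d0, zero_add, ih.1, ih.2] at e0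
    rw [e1, e0, prod_range_succ, hy]
    constructor <;> ring

/-- The quadratic form of a triple. -/
def tripleForm {k N : ℕ} (e : Fin k × Fin 3 ≃ Fin N) (c : Fin N → ZMod 2) (g : Fin k) : ZMod 2 :=
  ∑ i, c (e (g, i)) * height c (e (g, i)) +
    (c (e (g, 0)) * c (e (g, 1)) + c (e (g, 0)) * c (e (g, 2)) + c (e (g, 1)) * c (e (g, 2)))

theorem sum_mul_height {N : ℕ} (c : Fin N → ZMod 2) :
    ∑ v, c v * height c v = ∑ v, c v + ((∑ v, (c v).val).choose 2 : ℕ) := by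
  induction N with
  | zero => simp
  | succ N ih =>
    obtain ⟨c, a, rfl⟩ : ∃ (c' : Fin N → ZMod 2) (a : ZMod 2), c = Fin.snoc c' a :=
      ⟨_, _, (Fin.snoc_init_self c).symm⟩
    have hc : ((∑ v, (c v).val : ℕ) : ZMod 2) = ∑ v, c v := by simp
    simp only [Fin.sum_univ_castSucc, Fin.snoc_castSucc, Fin.snoc_last,
      Fin.val_castSucc, Fin.val_last, height_snoc _ _ le_rfl, height_snoc _ _ (Fin.is_lt _).le, ih,
      height_self]
    rw [← hc]
    generalize ∑ v, (c v).val = w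
    have : a = 0 ∨ a = 1 := by revert a; decide
    obtain rfl | rfl := this
    · simp
    · simp [show (1 : ZMod 2).val = 1 from rfl, Nat.choose_succ_succ w 1]
      linear_combination

theorem sum_tripleForm {k N : ℕ} (e : Fin k × Fin 3 ≃ Fin N) (c : Fin N → ZMod 2)
    (hc : ∀ g, ∑ i, c (e (g, i)) = 0) : ∑ g, tripleForm e c g = 0 := by
  have split {M : Type} [AddCommMonoid M] (f : Fin N → M) :
      ∑ v, f v = ∑ g, ∑ i, f (e (g, i)) := by
    rw [← e.sum_comp, Fintype.sum_prod_type]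
  have triple (a : Fin 3 → ZMod 2) (ha : ∑ i, a i = 0) :
      ∑ i, (a i).val = 2 * (a 0 * a 1 + a 0 * a 2 + a 1 * a 2).val := by
    revert a
    decide
  set n : Fin k → ZMod 2 := fun g =>
    c (e (g, 0)) * c (e (g, 1)) + c (e (g, 0)) * c (e (g, 2)) + c (e (g, 1)) * c (e (g, 2)) with hn
  have hw : ∑ v, (c v).val = 2 * ∑ g, (n g).val := by
    rw [split, mul_sum]
    exact sum_congr rfl fun g _ => triple (fun i => c (e (g, i))) (hc g)
  have hs : ∑ g, n g = ((∑ g, (n g).val : ℕ) : ZMod 2) := by simp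
  have h0 : ∑ v, c v = 0 := by rw [split]; exact sum_eq_zero fun g _ => hc g
  have hch (m : ℕ) : ((2 * m).choose 2 : ZMod 2) = m := by
    have : (2 * m).choose 2 + m = 2 * (m * m) := by
      induction m with
      | zero => simp
      | succ m ih =>
        rw [show 2 * (m + 1) = 2 * m + 1 + 1 by ring, Nat.choose_succ_succ _ 1,
          Nat.choose_succ_succ _ 1]
        simp
        linarith
    have := congrArg (Nat.cast : ℕ → ZMod 2) this
    push_cast at this
    linear_combination this + ((m : ZMod 2) * m - m) * CharTwo.two_eq_zero (R := ZMod 2)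
  have : ∑ g, tripleForm e c g = ∑ v, c v * height c v + ∑ g, n g := by
    rw [split, ← sum_add_distrib]
    rfl
  rw [this, sum_mul_height, h0, hw, hch, hs, zero_add, CharTwo.add_self_eq_zero]

open MvPolynomial in
theorem even_card_solutions {k N : ℕ} (e : Fin k × Fin 3 ≃ Fin N) (Z : Finset (Fin k))
    (hZ : Z ≠ univ) :
    2 ∣ #{c : Fin N → ZMod 2 | (∀ g, ∑ i, c (e (g, i)) = 0 ∧ tripleForm e c g = 0) ∧
      ∀ g ∈ Z, ∀ i, c (e (g, i)) = 0} := by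
  obtain ⟨g₀, hg₀⟩ : ∃ g, g ∉ Z := by simpa [Finset.ext_iff] using hZ
  let x (g : Fin k) (i : Fin 3) : MvPolynomial (Fin N) (ZMod 2) := X (e (g, i))
  let lin (g : Fin k) : MvPolynomial (Fin N) (ZMod 2) := ∑ i, x g i
  let ht (v : Fin N) : MvPolynomial (Fin N) (ZMod 2) :=
    1 + ∑ u : Fin N, if u.val < v then X u else 0
  let quad (g : Fin k) : MvPolynomial (Fin N) (ZMod 2) :=
    ∑ i, x g i * ht (e (g, i)) + (x g 0 * x g 1 + x g 0 * x g 2 + x g 1 * x g 2)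
  let f (g : Fin k) : MvPolynomial (Fin N) (ZMod 2) :=
    if g = g₀ then lin g
    else if g ∈ Z then 1 - (1 - x g 0) * (1 - x g 1) * (1 - x g 2)
    else 1 - (1 - lin g) * (1 - quad g)
  have dx (g i) : (x g i).totalDegree ≤ 1 := (totalDegree_X _).le
  have deg_one (d : ℕ) : (1 : MvPolynomial (Fin N) (ZMod 2)).totalDegree ≤ d := by simp
  have dsub {p q : MvPolynomial (Fin N) (ZMod 2)} {d : ℕ} (hp : p.totalDegree ≤ d)
      (hq : q.totalDegree ≤ d) : (p - q).totalDegree ≤ d :=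
    (totalDegree_sub _ _).trans (max_le hp hq)
  have dadd {p q : MvPolynomial (Fin N) (ZMod 2)} {d : ℕ} (hp : p.totalDegree ≤ d)
      (hq : q.totalDegree ≤ d) : (p + q).totalDegree ≤ d :=
    (totalDegree_add _ _).trans (max_le hp hq)
  have dmul {p q : MvPolynomial (Fin N) (ZMod 2)} {a b : ℕ} (hp : p.totalDegree ≤ a)
      (hq : q.totalDegree ≤ b) : (p * q).totalDegree ≤ a + b :=
    (totalDegree_mul _ _).trans (add_le_add hp hq)
  have dlin (g) : (lin g).totalDegree ≤ 1 := totalDegree_finsetSum_le fun i _ => dx g i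
  have dht (v) : (ht v).totalDegree ≤ 1 := by
    refine dadd (deg_one 1) (totalDegree_finsetSum_le fun u _ => ?_)
    split_ifs
    · exact (totalDegree_X _).le
    · simp
  have dquad (g) : (quad g).totalDegree ≤ 2 :=
    dadd (totalDegree_finsetSum_le fun i _ => dmul (dx g i) (dht _))
      (dadd (dadd (dmul (dx g 0) (dx g 1)) (dmul (dx g 0) (dx g 2))) (dmul (dx g 1) (dx g 2)))
  have df (g) (hg : g ≠ g₀) : (f g).totalDegree ≤ 3 := by
    simp only [f, if_neg hg]
    split_ifs
    · exact dsub (deg_one 3) (dmul (dmul (dsub (deg_one 1) (dx g 0)) (dsub (deg_one 1) (dx g 1)))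
        (dsub (deg_one 1) (dx g 2)))
    · exact dsub (deg_one 3) (dmul (dsub (deg_one 1) (dlin g)) (dsub (deg_one 2) (dquad g)))
  have hdeg : ∑ g, (f g).totalDegree < Fintype.card (Fin N) := by
    rw [← Fintype.card_congr e, Fintype.card_prod, Fintype.card_fin, Fintype.card_fin,
      ← add_sum_erase univ _ (mem_univ g₀)]
    have h1 : (f g₀).totalDegree ≤ 1 := by simpa [f] using dlin g₀
    have h2 : ∑ g ∈ univ.erase g₀, (f g).totalDegree ≤ (k - 1) * 3 := by
      refine (sum_le_card_nsmul _ _ 3 fun g hg => df g (ne_of_mem_erase hg)).trans ?_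
      simp
    have := g₀.pos
    lia
  have hdvd := char_dvd_card_solutions_of_fintype_sum_lt 2 hdeg
  rw [Fintype.card_subtype] at hdvd
  convert hdvd using 2
  refine filter_congr fun c _ => ?_
  have elin (g) : eval c (lin g) = ∑ i, c (e (g, i)) := by simp [lin, x]
  have equad (g) : eval c (quad g) = tripleForm e c g := by
    simp only [quad, x, ht, tripleForm, height, map_add, map_mul, map_sum, eval_X, map_one,
      apply_ite (eval c), map_zero]
  have ef (g) (hg : g ≠ g₀) : eval c (f g) = 0 ↔ (∑ i, c (e (g, i)) = 0 ∧ tripleForm e c g = 0) ∧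
      (g ∈ Z → ∀ i, c (e (g, i)) = 0) := by
    simp only [f, if_neg hg]
    split_ifs with hgZ
    · have hz : (∀ i, c (e (g, i)) = 0) →
          ∑ i, c (e (g, i)) = 0 ∧ tripleForm e c g = 0 := by
        intro h
        simp [tripleForm, h]
      have : ∀ a : Fin 3 → ZMod 2, 1 - (1 - a 0) * (1 - a 1) * (1 - a 2) = 0 ↔ ∀ i, a i = 0 := by
        decide
      have := this fun i => c (e (g, i))
      simp only [map_sub, map_mul, map_one, x, eval_X]
      tauto
    · have : ∀ a b : ZMod 2, 1 - (1 - a) * (1 - b) = 0 ↔ a = 0 ∧ b = 0 := by decide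
      simp only [map_sub, map_mul, map_one, elin, equad, this, hgZ, false_imp_iff, and_true]
  have ef₀ : eval c (f g₀) = 0 ↔ ∑ i, c (e (g₀, i)) = 0 := by simp [f, elin]
  constructor
  · rintro ⟨h, h'⟩ g
    by_cases hg : g = g₀
    · rw [hg, ef₀]
      exact (h g₀).1
    · exact (ef g hg).2 ⟨h g, h' g⟩
  · intro h
    have hl (g) : ∑ i, c (e (g, i)) = 0 := by
      by_cases hg : g = g₀
      · rw [hg, ← ef₀, h]
      · exact ((ef g hg).1 (h g)).1.1
    have hq (g) (hg : g ≠ g₀) : tripleForm e c g = 0 := ((ef g hg).1 (h g)).1.2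
    refine ⟨fun g => ⟨hl g, ?_⟩, fun g hg => ?_⟩
    · by_cases hg : g = g₀
      · rw [hg, ← sum_tripleForm e c hl, Fintype.sum_eq_single g₀ hq]
      · exact hq g hg
    · have hne : g ≠ g₀ := fun h => hg₀ (h ▸ hg)
      exact ((ef g hne).1 (h g)).2 hg

/-- The change vectors that encode the orientations with out-degrees `0`, `1`, `2` on each
triple. -/
def IsGood {k N : ℕ} (e : Fin k × Fin 3 ≃ Fin N) (c : Fin N → ZMod 2) : Prop :=
  ∀ g, ∑ i, c (e (g, i)) = 0 ∧ tripleForm e c g = 0 ∧ ¬ ∀ i, c (e (g, i)) = 0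

instance {k N : ℕ} (e : Fin k × Fin 3 ≃ Fin N) : DecidablePred (IsGood e) :=
  fun _ => inferInstanceAs (Decidable (∀ _, _))

theorem card_isGood_cast {k N : ℕ} (e : Fin k × Fin 3 ≃ Fin N) :
    (#{c | IsGood e c} : ZMod 2) = 1 := by
  let z (c : Fin N → ZMod 2) (g : Fin k) : ZMod 2 := if ∀ i, c (e (g, i)) = 0 then 1 else 0
  let sol : Finset (Fin N → ZMod 2) :=
    {c | ∀ g, ∑ i, c (e (g, i)) = 0 ∧ tripleForm e c g = 0}
  have hcount (Z : Finset (Fin k)) : ∑ c ∈ sol, ∏ g ∈ Z, z c g =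
      (#{c : Fin N → ZMod 2 | (∀ g, ∑ i, c (e (g, i)) = 0 ∧ tripleForm e c g = 0) ∧
        ∀ g ∈ Z, ∀ i, c (e (g, i)) = 0} : ZMod 2) := by
    rw [← filter_filter, natCast_card_filter]
    refine sum_congr rfl fun c _ => ?_
    simp only [z]
    rw [prod_boole]
    congr
  calc (#{c | IsGood e c} : ZMod 2) = ∑ c ∈ sol, ∏ g, (1 + z c g) := by
        have h1 (c) (g) : 1 + z c g = if ¬ ∀ i, c (e (g, i)) = 0 then 1 else 0 := by
          by_cases h : ∀ i, c (e (g, i)) = 0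
          · rw [if_neg (not_not.2 h)]
            simp only [z, if_pos h]
            decide
          · rw [if_pos h]
            simp only [z, if_neg h, add_zero]
        have h2 : ({c | IsGood e c} : Finset (Fin N → ZMod 2)) =
            {c ∈ sol | ∀ g ∈ univ, ¬ ∀ i, c (e (g, i)) = 0} := by
          rw [filter_filter]
          refine filter_congr fun c _ => ?_
          simp only [IsGood, forall_and, mem_univ, true_imp_iff, and_assoc]
        rw [h2, natCast_card_filter]
        refine sum_congr rfl fun c _ => ?_
        simp only [h1]
        rw [prod_boole]
        congr
    _ = ∑ Z : Finset (Fin k), ∑ c ∈ sol, ∏ g ∈ Z, z c g := by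
        simp only [prod_one_add, powerset_univ]
        exact sum_comm
    _ = ∑ c ∈ sol, ∏ g, z c g := by
        refine Fintype.sum_eq_single univ fun Z hZ => ?_
        rw [hcount, ZMod.natCast_eq_zero_iff]
        exact even_card_solutions e Z hZ
    _ = 1 := by
        rw [hcount]
        have : ({c : Fin N → ZMod 2 | (∀ g, ∑ i, c (e (g, i)) = 0 ∧ tripleForm e c g = 0) ∧
            ∀ g ∈ (univ : Finset (Fin k)), ∀ i, c (e (g, i)) = 0} : Finset _) = {0} := by
          ext c
          simp only [mem_filter, mem_univ, true_and, true_imp_iff, mem_singleton]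
          constructor
          · rintro ⟨-, h⟩
            funext v
            simpa using h (e.symm v).1 (e.symm v).2
          · rintro rfl
            simp [tripleForm]
        rw [this]
        simp

theorem height_and_bijective_iff_isGood {k N : ℕ} (e : Fin k × Fin 3 ≃ Fin N) (c : Fin N → ZMod 2) :
    (height c N = 1 ∧ ∀ g, Function.Bijective fun i =>
      outdeg (height c (e (g, i))) (c (e (g, i)))) ↔ IsGood e c := by
  simp only [bijective_outdeg_iff]
  refine ⟨fun h => h.2, fun h => ⟨?_, h⟩⟩
  rw [height_self, ← e.sum_comp, Fintype.sum_prod_type, sum_eq_zero fun g _ => (h g).1, add_zero]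

theorem exists_rainbow_coloring_of_root {R : Type*} [CommRing R] [Nontrivial R]
    (hR : ∀ a : R, a + a = 0) (w : R)
    (hw₁ : ∀ d : Fin 3 → Fin 3, Function.Bijective d →
      ∑ σ : Equiv.Perm (Fin 3), ∏ i, (w ^ (σ i).val) ^ (d i).val = 1)
    (hw₀ : ∀ d : Fin 3 → Fin 3, ¬ Function.Bijective d →
      ∑ σ : Equiv.Perm (Fin 3), ∏ i, (w ^ (σ i).val) ^ (d i).val = 0)
    {k N : ℕ} (e : Fin k × Fin 3 ≃ Fin N) :
    ∃ π : Fin k → Equiv.Perm (Fin 3), ∀ p q : Fin k × Fin 3,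
      (e p).val + 1 = (e q).val → π p.1 p.2 ≠ π q.1 q.2 := by
  let x (π : Fin k → Equiv.Perm (Fin 3)) (v : ℕ) : R :=
    if h : v < N then w ^ (π (e.symm ⟨v, h⟩).1 (e.symm ⟨v, h⟩).2).val else 0
  let y (π : Fin k → Equiv.Perm (Fin 3)) (v : ℕ) : R := if v = 0 then 0 else x π (v - 1)
  have hx (π p) : x π (e p) = w ^ (π p.1 p.2).val := by simp [x]
  have hsum : ∑ π, ∏ v ∈ range N, (x π v + y π v) ≠ 0 := by
    have h1 (c : Fin N → ZMod 2) :
        ∑ π, ∏ v : Fin N, x π v ^ (outdeg (height c v) (c v)).val =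
          ∏ g, ∑ σ : Equiv.Perm (Fin 3), ∏ i,
            (w ^ (σ i).val) ^ (outdeg (height c (e (g, i))) (c (e (g, i)))).val := by
      calc _ = ∑ π : Fin k → Equiv.Perm (Fin 3), ∏ g, ∏ i,
            (w ^ (π g i).val) ^ (outdeg (height c (e (g, i))) (c (e (g, i)))).val := by
            refine sum_congr rfl fun π _ => ?_
            rw [← e.prod_comp, Fintype.prod_prod_type]
            simp only [hx]
        _ = ∏ g, ∑ σ : Equiv.Perm (Fin 3), ∏ i,
            (w ^ (σ i).val) ^ (outdeg (height c (e (g, i))) (c (e (g, i)))).val :=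
            (Fintype.prod_sum fun (g : Fin k) (σ : Equiv.Perm (Fin 3)) => ∏ i,
              (w ^ (σ i).val) ^ (outdeg (height c (e (g, i))) (c (e (g, i)))).val).symm
    have h2 : ∑ π, ∏ v ∈ range N, (x π v + y π v) = (#{c | IsGood e c} : R) := by
      simp only [← fun π => (sum_prod_pow_outdeg (x π) (y π) rfl (fun _ => rfl) N).1]
      rw [sum_comm, natCast_card_filter]
      refine sum_congr rfl fun c _ => ?_
      split_ifs with hN hc hc
      · rw [h1, prod_eq_one fun g _ => hw₁ _ (((height_and_bijective_iff_isGood e c).2 hc).2 g)]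
      · obtain ⟨g, hg⟩ := not_forall.1 fun h => hc ((height_and_bijective_iff_isGood e c).1 ⟨hN, h⟩)
        rw [h1, prod_eq_zero (mem_univ g) (hw₀ _ hg)]
      · exact absurd ((height_and_bijective_iff_isGood e c).2 hc).1 hN
      · exact sum_const_zero
    have h3 : Odd #{c | IsGood e c} := ZMod.natCast_eq_one_iff_odd.1 (card_isGood_cast e)
    obtain ⟨j, hj⟩ := h3
    rw [h2, hj]
    push_cast
    rw [two_mul, hR, zero_add]
    exact one_ne_zero
  obtain ⟨π, -, hπ⟩ := exists_ne_zero_of_sum_ne_zero hsum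
  refine ⟨π, fun p q hpq heq => hπ ?_⟩
  refine prod_eq_zero (mem_range.2 (e q).is_lt) ?_
  have : y π (e q) = x π (e p) := by
    simp only [y, ← hpq]
    simp
  rw [this, hx, hx, heq, hR]

/-- The path-plus-triangles theorem: a path whose vertices are partitioned into triples has a proper
colouring with three colours that uses every colour once on each triple. -/
theorem exists_rainbow_coloring_fin {k N : ℕ} (e : Fin k × Fin 3 ≃ Fin N) :
    ∃ π : Fin k → Equiv.Perm (Fin 3), ∀ p q : Fin k × Fin 3,
      (e p).val + 1 = (e q).val → π p.1 p.2 ≠ π q.1 q.2 :=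
  have : Nontrivial F4 := ⟨0, 1, by decide⟩
  exists_rainbow_coloring_of_root F4.add_self omega4
    (fun d hd => (sum_perm_omega4 d).trans (if_pos hd))
    (fun d hd => (sum_perm_omega4 d).trans (if_neg hd)) e

theorem exists_rainbow_coloring_three {k : ℕ} (p : Fin k × Fin 3 → ℕ)
    (hp : Function.Injective p) :
    ∃ π : Fin k → Equiv.Perm (Fin 3), ∀ a b, p a + 1 = p b → π a.1 a.2 ≠ π b.1 b.2 := by
  have hcard : Fintype.card (Set.range p) = k * 3 := by
    simp [← Fintype.card_congr (Equiv.ofInjective p hp)]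
  let r := monoEquivOfFin (Set.range p) hcard
  obtain ⟨π, hπ⟩ := exists_rainbow_coloring_fin ((Equiv.ofInjective p hp).trans r.symm.toEquiv)
  refine ⟨π, fun a b hab => hπ a b ?_⟩
  have hcov : (⟨p a, a, rfl⟩ : Set.range p) ⋖ ⟨p b, b, rfl⟩ := by
    refine ⟨Subtype.mk_lt_mk.2 (by lia), fun c h1 h2 => ?_⟩
    have h1 : p a < c.1 := h1
    have h2 : c.1 < p b := h2
    lia
  exact Nat.covBy_iff_add_one_eq.1 (Fin.covBy_iff.1 ((apply_covBy_apply_iff r.symm).2 hcov))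

/-- For `n ≥ 3`, if some natural numbers are partitioned into groups of size `n`, then they have a
colouring with `n` colours that is injective on each group and separates consecutive numbers. -/
theorem exists_rainbow_coloring {n : ℕ} (hn : 3 ≤ n) {k : ℕ} (p : Fin k × Fin n → ℕ)
    (hp : Function.Injective p) :
    ∃ col : Fin k → Fin n → Fin n, (∀ g, Function.Injective (col g)) ∧
      ∀ a b, p a + 1 = p b → col a.1 a.2 ≠ col b.1 b.2 := by
  induction n, hn using Nat.le_induction with
  | base =>
    obtain ⟨π, hπ⟩ := exists_rainbow_coloring_three p hp
    exact ⟨fun g => π g, fun g => (π g).injective, hπ⟩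
  | succ n hn ih =>
    have h3 : 3 ≤ n + 1 := by lia
    obtain ⟨π, hπ⟩ := exists_rainbow_coloring_three (fun x => p (x.1, Fin.castLE h3 x.2))
      fun x y h => by simpa [Prod.ext_iff] using hp h
    let t (g : Fin k) : Fin (n + 1) := Fin.castLE h3 ((π g).symm 0)
    have ht (g g') : p (g, t g) + 1 ≠ p (g', t g') := fun h =>
      hπ (g, (π g).symm 0) (g', (π g').symm 0) h (by simp)
    obtain ⟨col, hinj, hcol⟩ := ih (fun x => p (x.1, (t x.1).succAbove x.2)) fun x y h => by
      have h := hp h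
      obtain ⟨g, i⟩ := x
      obtain ⟨g', i'⟩ := y
      obtain ⟨rfl, h⟩ := Prod.ext_iff.1 h
      exact Prod.ext rfl (Fin.succAbove_right_injective h)
    let col' (g : Fin k) : Fin (n + 1) → Fin (n + 1) :=
      (t g).insertNth (α := fun _ => Fin (n + 1)) (Fin.last n) fun i => (col g i).castSucc
    have c1 (g) : col' g (t g) = Fin.last n := Fin.insertNth_apply_same ..
    have c2 (g i) : col' g ((t g).succAbove i) = (col g i).castSucc :=
      Fin.insertNth_apply_succAbove ..
    refine ⟨col', fun g i j h => ?_, ?_⟩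
    · obtain rfl | ⟨i, rfl⟩ := Fin.eq_self_or_eq_succAbove (t g) i <;>
        obtain rfl | ⟨j, rfl⟩ := Fin.eq_self_or_eq_succAbove (t g) j
      · rfl
      · rw [c1, c2] at h
        exact absurd h.symm (Fin.castSucc_ne_last _)
      · rw [c1, c2] at h
        exact absurd h (Fin.castSucc_ne_last _)
      · rw [c2, c2, Fin.castSucc_inj] at h
        rw [hinj g h]
    · rintro ⟨g, i⟩ ⟨g', j⟩ h h'
      dsimp only at h'
      obtain rfl | ⟨i, rfl⟩ := Fin.eq_self_or_eq_succAbove (t g) i <;>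
        obtain rfl | ⟨j, rfl⟩ := Fin.eq_self_or_eq_succAbove (t g') j
      · exact ht g g' h
      · rw [c1, c2] at h'
        exact Fin.castSucc_ne_last _ h'.symm
      · rw [c1, c2] at h'
        exact Fin.castSucc_ne_last _ h'
      · rw [c2, c2, Fin.castSucc_inj] at h'
        exact hcol (g, i) (g', j) h h'

/-- for n ≥ 3 agents with an identical additive (possibly non-monotone)
valuation on a path graph, a complete (hence maximal) EF[1,1] allocation exists. -/
theorem stmt_16 (n m : ℕ) (hn : 3 ≤ n) (w : Fin m → ℝ) :
    ∃ A : Fin n → Finset (Fin m),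
      (∀ i j : Fin n, i ≠ j → Disjoint (A i) (A j)) ∧
      (∀ i : Fin n, ∀ x ∈ A i, ∀ y ∈ A i, ¬ (x.val + 1 = y.val ∨ y.val + 1 = x.val)) ∧
      (∀ o : Fin m, ∃ i : Fin n, o ∈ A i) ∧
      (∀ i j : Fin n, ∃ S ⊆ A i, ∃ T ⊆ A j, S.card ≤ 1 ∧ T.card ≤ 1 ∧
        (∑ o ∈ A i \ S, w o) ≥ (∑ o ∈ A j \ T, w o)) := by
  obtain _ | m := m
  · exact ⟨fun _ => ∅, by simp, by simp, fun o => o.elim0, fun i j => ⟨∅, by simp, ∅, by simp⟩⟩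
  have hle : m + 1 ≤ (m + 1) * n := Nat.le_mul_of_pos_right _ (by lia)
  let w' (v : Fin ((m + 1) * n)) : ℝ := if h : v.val < m + 1 then w ⟨v, h⟩ else 0
  have hw' (o : Fin (m + 1)) : w' (Fin.castLE hle o) = w o := dif_pos o.is_lt
  let σ := Tuple.sort fun v => -w' v
  have hσ {x y} (h : x ≤ y) : w' (σ y) ≤ w' (σ x) :=
    neg_le_neg_iff.1 (Tuple.monotone_sort (fun v => -w' v) h)
  let P : Fin (m + 1) × Fin n ≃ Fin ((m + 1) * n) := finProdFinEquiv.trans σ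
  obtain ⟨col, hinj, hcol⟩ := exists_rainbow_coloring hn (fun x => (P x).val)
    (Fin.val_injective.comp P.injective)
  let τ (g : Fin (m + 1)) : Equiv.Perm (Fin n) :=
    Equiv.ofBijective _ (Finite.injective_iff_bijective.1 (hinj g))
  let loc (o : Fin (m + 1)) : Fin (m + 1) × Fin n := P.symm (Fin.castLE hle o)
  have hloc (o) : P (loc o) = Fin.castLE hle o := P.apply_symm_apply _
  let A (a : Fin n) : Finset (Fin (m + 1)) := {o | τ (loc o).1 (loc o).2 = a}
  have hA {a o} : o ∈ A a ↔ τ (loc o).1 (loc o).2 = a := by simp [A]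
  have hcard (a) (r) : #{o ∈ A a | (loc o).1 = r} ≤ 1 := by
    refine card_le_one.2 fun x hx y hy => ?_
    obtain ⟨hxA, rfl⟩ := mem_filter.1 hx
    obtain ⟨hyA, h⟩ := mem_filter.1 hy
    rw [hA] at hxA hyA
    rw [h, ← hxA] at hyA
    have := congrArg P (Prod.ext h ((τ _).injective hyA))
    rw [hloc, hloc] at this
    exact (Fin.castLE_injective hle this).symm
  let u (a : Fin n) (g : Fin (m + 1)) : ℝ := w' (P (g, (τ g).symm a))
  have hu (a b) (g : Fin m) : u b g.succ ≤ u a g.castSucc := by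
    refine hσ (Fin.le_def.2 ?_)
    simp only [finProdFinEquiv_apply_val, Fin.val_succ, Fin.val_castSucc]
    have := ((τ g.castSucc).symm a).is_lt
    lia
  have hsum (a r) : ∑ o ∈ A a \ {o ∈ A a | (loc o).1 = r}, w o =
      ∑ g, if g = r then 0 else u a g := by
    let f (v : Fin ((m + 1) * n)) : ℝ :=
      if τ (P.symm v).1 (P.symm v).2 = a ∧ (P.symm v).1 ≠ r then w' v else 0
    calc ∑ o ∈ A a \ {o ∈ A a | (loc o).1 = r}, w o
        = ∑ o, f (Fin.castLE hle o) := by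
          rw [← filter_not, filter_filter, sum_filter]
          refine sum_congr rfl fun o _ => ?_
          simp [f, hw', loc]
      _ = ∑ v, f v := by
          refine Fintype.sum_of_injective _ (Fin.castLE_injective hle) _ _ (fun v hv => ?_)
            fun _ => rfl
          have : w' v = 0 := dif_neg fun h => hv ⟨⟨v, h⟩, rfl⟩
          simp [f, this]
      _ = _ := by
          rw [← P.sum_comp, Fintype.sum_prod_type]
          refine sum_congr rfl fun g _ => ?_
          rw [Fintype.sum_eq_single ((τ g).symm a)]
          · by_cases h : g = r <;> simp [f, u, h]
          · intro i hi
            have : τ g i ≠ a := fun h => hi (by simp [← h])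
            simp [f, this]
  refine ⟨A, fun i j hij => ?_, fun i x hx y hy => ?_, fun o => ⟨_, hA.2 rfl⟩, fun i j =>
    ⟨_, filter_subset (fun o => (loc o).1 = Fin.last m) _, _,
      filter_subset (fun o => (loc o).1 = 0) _, hcard _ _, hcard _ _, ?_⟩⟩
  · exact disjoint_left.2 fun o hi hj => hij ((hA.1 hi).symm.trans (hA.1 hj))
  · rw [hA] at hx hy
    have key (x y : Fin (m + 1)) (h : x.val + 1 = y.val) :
        τ (loc x).1 (loc x).2 ≠ τ (loc y).1 (loc y).2 :=
      hcol _ _ (by simpa [hloc] using h)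
    rintro (h | h)
    · exact key x y h (hx.trans hy.symm)
    · exact key y x h (hy.trans hx.symm)
  · rw [hsum, hsum, Fin.sum_univ_castSucc, Fin.sum_univ_succ]
    simpa [Fin.castSucc_ne_last] using sum_le_sum fun g _ => hu i j g
end

section
/- For every integer n ≥ 3, every set of items o_1,...,o_m whose conflict graph is the path with edges {o_i, o_{i+1}} for i = 1,...,m−1, and every additive monotone valuation v shared by all n agents (i.e., either v({o}) ≥ 0 for every item o, or v({o}) ≤ 0 for every item o), there exists a complete (and therefore maximal) allocation (A_1,...,A_n) that is EF1. -/
section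

open Finset

theorem sum_pi_eq_zero_of_sum_update {ι κ R : Type*} [Fintype ι] [DecidableEq ι] [Fintype κ]
    [AddCommMonoid R] (f : (ι → κ) → R) (i : ι)
    (h : ∀ s, ∑ x, f (Function.update s i x) = 0) : ∑ s, f s = 0 := by
  rw [← (Equiv.funSplitAt i κ).symm.sum_comp, Fintype.sum_prod_type_right]
  refine sum_eq_zero fun r _ => ?_
  rcases isEmpty_or_nonempty κ with _ | ⟨⟨x₀⟩⟩
  · simp
  · rw [← h ((Equiv.funSplitAt i κ).symm (x₀, r))]
    refine sum_congr rfl fun x _ => congrArg f ?_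
    ext j
    by_cases hj : j = i
    · subst hj; simp [Equiv.funSplitAt, Equiv.piSplitAt]
    · simp [Equiv.funSplitAt, Equiv.piSplitAt, hj]

/-- The left-hand side is a sum over all maps `φ : ι → ι` of `∑ s, ∏ i, b i (s i) (φ i) (s (φ i))`.
The terms of the maps that are not bijective vanish, and so do those of the involutions other than
the identity; the remaining bijections cancel against their inverses. -/
theorem sum_prod_sum_eq_one {ι κ : Type*} [Fintype ι] [DecidableEq ι] [Fintype κ]
    (hκ : (Fintype.card κ : ZMod 2) = 1) (b : ι → κ → ι → κ → ZMod 2)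
    (hdiag : ∀ i x, b i x i x = 1)
    (hsymm : ∀ i x j y, i ≠ j → b i x j y = b j y i x)
    (hsum : ∀ i j y, i ≠ j → ∑ x, b i x j y = 0) :
    ∑ s : ι → κ, ∏ i, ∑ j, b i (s i) j (s j) = 1 := by
  have hsymm' : ∀ (s : ι → κ) i j, b i (s i) j (s j) = b j (s j) i (s i) := by
    intro s i j
    by_cases h : i = j
    · rw [h]
    · exact hsymm _ _ _ _ h
  let W : (ι → ι) → ZMod 2 := fun φ => ∑ s : ι → κ, ∏ i, b i (s i) (φ i) (s (φ i))
  have hW : ∑ s : ι → κ, ∏ i, ∑ j, b i (s i) j (s j) = ∑ φ, W φ := by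
    simp only [Fintype.prod_sum]
    exact sum_comm
  have hsurj : ∀ φ : ι → ι, ¬ Function.Bijective φ → W φ = 0 := by
    intro φ hφ
    rw [← Finite.surjective_iff_bijective] at hφ
    simp only [Function.Surjective, not_forall, not_exists] at hφ
    obtain ⟨i, hi⟩ := hφ
    refine sum_pi_eq_zero_of_sum_update _ i fun s => ?_
    have : ∀ x, ∏ j, b j (Function.update s i x j) (φ j) (Function.update s i x (φ j)) =
        b i x (φ i) (s (φ i)) * ∏ j ∈ univ.erase i, b j (s j) (φ j) (s (φ j)) := by
      intro x
      rw [← mul_prod_erase univ _ (mem_univ i)]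
      congr 1
      · simp [hi]
      · refine prod_congr rfl fun j hj => ?_
        simp [hi, ne_of_mem_erase hj]
    simp only [this, ← sum_mul]
    rw [hsum i (φ i) _ (Ne.symm (hi i)), zero_mul]
  have hinv : ∀ σ : Equiv.Perm ι, σ ≠ 1 → σ⁻¹ = σ → W σ = 0 := by
    intro σ hσ hσi
    obtain ⟨i, hi⟩ : ∃ i, σ i ≠ i := by
      by_contra! h
      exact hσ (Equiv.ext h)
    have hσσ : ∀ j, σ (σ j) = j := fun j => by
      have h : σ⁻¹ (σ j) = j := by simp
      rwa [hσi] at h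
    refine sum_pi_eq_zero_of_sum_update _ i fun s => ?_
    have : ∀ x, ∏ j, b j (Function.update s i x j) (σ j) (Function.update s i x (σ j)) =
        b i x (σ i) (s (σ i)) *
          ∏ j ∈ (univ.erase i).erase (σ i), b j (s j) (σ j) (s (σ j)) := by
      intro x
      rw [← mul_prod_erase univ _ (mem_univ i),
        ← mul_prod_erase (univ.erase i) _ (mem_erase.2 ⟨hi, mem_univ (σ i)⟩), ← mul_assoc]
      congr 1
      · have h2 : ∀ z : ZMod 2, z * z = z := by decide
        simp [hi, hσσ, hsymm (σ i) (s (σ i)) i x hi, h2]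
      · refine prod_congr rfl fun j hj => ?_
        have h1 : j ≠ i := ne_of_mem_erase (mem_of_mem_erase hj)
        have h2 : σ j ≠ i := fun h => ne_of_mem_erase hj (by rw [← h, hσσ])
        simp [h1, h2]
    simp only [this, ← sum_mul]
    rw [hsum i (σ i) _ (Ne.symm hi), zero_mul]
  have hWinv : ∀ σ : Equiv.Perm ι, W ⇑σ⁻¹ = W σ := by
    intro σ
    refine sum_congr rfl fun s _ => ?_
    rw [← Equiv.prod_comp σ]
    exact prod_congr rfl fun i _ => by simp [hsymm' s (σ i) i]
  have hperm : ∑ φ, W φ = ∑ σ : Equiv.Perm ι, W σ := by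
    symm
    refine sum_of_injOn (fun σ : Equiv.Perm ι => (σ : ι → ι))
      (DFunLike.coe_injective.injOn) (by simp) ?_ (by simp)
    intro φ _ hφ
    refine hsurj φ fun hb => hφ ?_
    exact ⟨Equiv.ofBijective φ hb, by simp, rfl⟩
  rw [hW, hperm, ← add_sum_erase univ _ (mem_univ (1 : Equiv.Perm ι))]
  have h0 : ∑ σ ∈ univ.erase (1 : Equiv.Perm ι), W σ = 0 := by
    refine sum_involution (fun σ _ => σ⁻¹) ?_ ?_ ?_ ?_
    · intro σ _
      rw [hWinv]
      exact CharTwo.add_self_eq_zero _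
    · intro σ hσ h hi
      exact h (hinv σ (ne_of_mem_erase hσ) hi)
    · intro σ hσ
      simpa using hσ
    · simp
  rw [h0, add_zero]
  simp [W, hdiag, hκ]

/-- The quadratic algebra `𝔽₂[ω] / (ω² = 1 + ω)`, a model of the field with four elements that the
kernel can compute in. -/
abbrev QuadraticF4 := QuadraticAlgebra (ZMod 2) 1 1

/-- Summing a monomial in three distinct cube roots of unity over all their orders detects whether
the exponents are distinct modulo `3`; for exponents `e j - e' j` with `e j, e' j ∈ {0, 1}` this
says that exactly two of the `e j - e' j` are nonzero, and that these two have opposite signs. -/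
theorem sum_perm_prod_omega_pow (e e' : Fin 3 → ZMod 2) :
    ∑ ρ : Equiv.Perm (Fin 3), ∏ j, (QuadraticAlgebra.omega : QuadraticF4) ^
      ((ρ j : ℕ) * ((1 + (e j).val) + (2 - (e' j).val))) =
    algebraMap (ZMod 2) _ (∑ o, (∏ j, if e j - e' j = (if j = o then 0 else 1) then 1 else 0) *
       ∑ j, if j = o then 0 else e j) := by
  decide +revert

/-- Choose an element `s i` to discard from each of finitely many disjoint triples in a linear order.
The number of choices for which the two elements kept in each triple have ranks of opposite parity
among all the elements kept is odd. -/
theorem sum_prod_crossings_eq_one {ι α : Type*} [Fintype ι] [DecidableEq ι] [LinearOrder α]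
    (p : ι × Fin 3 → α) (hp : Function.Injective p) :
    ∑ s : ι → Fin 3, ∏ i, ∑ x, (if x = s i then (0 : ZMod 2) else
      ∑ j, ∑ y, if y = s j then 0 else if p (j, y) ≤ p (i, x) then 1 else 0) = 1 := by
  let b : ι → Fin 3 → ι → Fin 3 → ZMod 2 := fun i u j v =>
    ∑ x, if x = u then 0 else ∑ y, if y = v then 0 else if p (j, y) ≤ p (i, x) then 1 else 0
  have hle : ∀ v w, v ≠ w → ((if p w ≤ p v then 1 else 0 : ZMod 2) =
      1 + (if p v ≤ p w then 1 else 0)) := by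
    intro v w hvw
    rcases lt_or_gt_of_ne (hp.ne hvw) with h | h
    · simp [h.le, not_le.2 h]; decide
    · simp [h.le, not_le.2 h]
  refine Eq.trans ?_ (sum_prod_sum_eq_one (by decide) b ?_ ?_ ?_)
  · refine sum_congr rfl fun s _ => prod_congr rfl fun i _ => ?_
    rw [sum_comm]
    refine sum_congr rfl fun x _ => ?_
    split_ifs <;> simp
  · intro i u
    have h01 := hle (i, 0) (i, 1) (by simp)
    have h02 := hle (i, 0) (i, 2) (by simp)
    have h12 := hle (i, 1) (i, 2) (by simp)
    simp only [b, Fin.sum_univ_three, h01, h02, h12, le_refl]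
    generalize (if p (i, 0) ≤ p (i, 1) then 1 else 0 : ZMod 2) = a
    generalize (if p (i, 0) ≤ p (i, 2) then 1 else 0 : ZMod 2) = a'
    generalize (if p (i, 1) ≤ p (i, 2) then 1 else 0 : ZMod 2) = a''
    decide +revert
  · intro i u j v hij
    have h : ∀ x y, ((if p (i, x) ≤ p (j, y) then 1 else 0 : ZMod 2) =
      1 + (if p (j, y) ≤ p (i, x) then 1 else 0)) := fun x y => hle _ _ (by simp [hij.symm])
    simp only [b, h]
    generalize hf : (fun x y => (if p (j, y) ≤ p (i, x) then 1 else 0 : ZMod 2)) = f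
    have hf' : ∀ x y, (if p (j, y) ≤ p (i, x) then 1 else 0 : ZMod 2) = f x y := by simp [← hf]
    simp only [hf']
    have h4 : (4 : ZMod 2) = 0 := by decide
    fin_cases u <;> fin_cases v <;> simp [Fin.sum_univ_three] <;> linear_combination -h4
  · intro i j v hij
    have key : ∀ g : Fin 3 → ZMod 2, ∑ u, ∑ x, (if x = u then 0 else g x) = 0 := by decide
    exact key _

/-- If the vertices of a path are partitioned into triples, the path has a proper `3`-coloring in
which every triple is rainbow: weighted by suitable elements of the field with four elements, these
colorings sum to `1`. -/
theorem exists_rainbow_coloring_fin_s17 {ι : Type*} [Fintype ι] [DecidableEq ι] {l : ℕ}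
    (τ : Fin (l + 1) ≃ ι × Fin 3) :
    ∃ π : ι → Equiv.Perm (Fin 3), ∀ i : Fin (l + 1), i ≠ Fin.last l →
      π (τ i).1 (τ i).2 ≠ π (τ (i + 1)).1 (τ (i + 1)).2 := by
  by_contra! hcon
  let ω : QuadraticF4 := QuadraticAlgebra.omega
  let X : (ι → Equiv.Perm (Fin 3)) → Fin (l + 1) → QuadraticF4 := fun π i =>
    ω ^ (π (τ i).1 (τ i).2 : ℕ)
  let δ : Fin (l + 1) → ZMod 2 → ZMod 2 := fun i e => if i = Fin.last l ∧ e = 1 then 0 else 1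
  let G : (Fin (l + 1) → ZMod 2) → ZMod 2 := fun ε => ∏ i, δ i (ε i)
  have h2 : (2 : QuadraticF4) = 0 := by decide
  have hzero : ∑ π : ι → Equiv.Perm (Fin 3), ∏ i, ∑ e : ZMod 2,
      algebraMap (ZMod 2) QuadraticF4 (δ i e) *
        (X π i ^ (1 + e.val) * X π (i + 1) ^ (2 - e.val)) = 0 := by
    refine sum_eq_zero fun π _ => ?_
    obtain ⟨i, hi, h⟩ := hcon π
    refine prod_eq_zero (mem_univ i) ?_
    have hX : X π (i + 1) = X π i := by simp only [X, h]
    rw [hX]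
    change ∑ e : Fin 2, _ = _
    rw [Fin.sum_univ_two]
    simp [δ, hi, ZMod.val]
    linear_combination (X π i ^ 3) * h2
  have hexp : ∑ π : ι → Equiv.Perm (Fin 3), ∏ i, ∑ e : ZMod 2,
      algebraMap (ZMod 2) QuadraticF4 (δ i e) *
        (X π i ^ (1 + e.val) * X π (i + 1) ^ (2 - e.val)) =
      ∑ ε : Fin (l + 1) → ZMod 2, algebraMap (ZMod 2) QuadraticF4 (G ε) *
        ∑ π : ι → Equiv.Perm (Fin 3), ∏ t, ∏ j, ω ^ ((π t j : ℕ) *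
          ((1 + (ε (τ.symm (t, j))).val) + (2 - (ε (τ.symm (t, j) - 1)).val))) := by
    simp only [Fintype.prod_sum]
    rw [sum_comm]
    refine sum_congr rfl fun ε _ => ?_
    rw [mul_sum]
    refine sum_congr rfl fun π _ => ?_
    rw [prod_mul_distrib, map_prod, prod_mul_distrib]
    congr 1
    have hshift : ∏ i, X π (i + 1) ^ (2 - (ε i).val) = ∏ i, X π i ^ (2 - (ε (i - 1)).val) := by
      rw [← Equiv.prod_comp (Equiv.addRight (1 : Fin (l + 1)))
        (fun i => X π i ^ (2 - (ε (i - 1)).val))]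
      simp
    rw [hshift, ← prod_mul_distrib, ← Fintype.prod_prod_type'
      (f := fun t j => ω ^ ((π t j : ℕ) *
        ((1 + (ε (τ.symm (t, j))).val) + (2 - (ε (τ.symm (t, j) - 1)).val)))), ← Equiv.prod_comp τ]
    refine prod_congr rfl fun i _ => ?_
    simp [X, ← pow_mul, ← pow_add, mul_add]
  have hloc : ∀ ε : Fin (l + 1) → ZMod 2,
      ∑ π : ι → Equiv.Perm (Fin 3), ∏ t, ∏ j, ω ^ ((π t j : ℕ) *
          ((1 + (ε (τ.symm (t, j))).val) + (2 - (ε (τ.symm (t, j) - 1)).val))) =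
      algebraMap (ZMod 2) QuadraticF4 (∑ s : ι → Fin 3, ∏ t, ((∏ j, if ε (τ.symm (t, j)) -
        ε (τ.symm (t, j) - 1) = (if j = s t then 0 else 1) then 1 else 0) *
          ∑ j, if j = s t then 0 else ε (τ.symm (t, j)))) := by
    intro ε
    rw [← Fintype.prod_sum fun t (ρ : Equiv.Perm (Fin 3)) => ∏ j, ω ^ ((ρ j : ℕ) *
          ((1 + (ε (τ.symm (t, j))).val) + (2 - (ε (τ.symm (t, j) - 1)).val))),
      ← Fintype.prod_sum fun t (o : Fin 3) => ((∏ j, if ε (τ.symm (t, j)) -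
        ε (τ.symm (t, j) - 1) = (if j = o then 0 else 1) then 1 else 0) *
          ∑ j, if j = o then 0 else ε (τ.symm (t, j))), map_prod]
    exact prod_congr rfl fun t _ =>
      sum_perm_prod_omega_pow (fun j => ε (τ.symm (t, j))) fun j => ε (τ.symm (t, j) - 1)
  simp only [hloc, ← map_mul, ← map_sum] at hexp
  rw [hexp] at hzero
  have hone : ∑ ε : Fin (l + 1) → ZMod 2, G ε * ∑ s : ι → Fin 3, ∏ t, ((∏ j,
      if ε (τ.symm (t, j)) - ε (τ.symm (t, j) - 1) = (if j = s t then 0 else 1) then 1 else 0) *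
          ∑ j, if j = s t then 0 else ε (τ.symm (t, j))) = 1 := by
    refine Eq.trans ?_
      (sum_prod_crossings_eq_one (τ.symm : ι × Fin 3 → Fin (l + 1)) τ.symm.injective)
    rw [sum_congr rfl fun ε _ => mul_sum _ _ _, sum_comm]
    refine sum_congr rfl fun s _ => ?_
    let d : Fin (l + 1) → ZMod 2 := fun i => if (τ i).2 = s (τ i).1 then 0 else 1
    let E : Fin (l + 1) → ZMod 2 := fun i => ∑ i', if i' ≤ i then d i' else 0
    have hElast : E (Fin.last l) = 0 := by
      simp only [E, Fin.le_last, if_true]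
      rw [← Equiv.sum_comp τ.symm, Fintype.sum_prod_type]
      refine sum_eq_zero fun t _ => ?_
      simp only [d, Equiv.apply_symm_apply]
      generalize s t = o
      decide +revert
    have hE0 : E 0 = d 0 := by simp [E]
    have hEsucc : ∀ i : Fin l, E i.succ - E i.castSucc = d i.succ := by
      intro i
      simp only [E, ← sum_sub_distrib]
      rw [Fintype.sum_eq_single i.succ]
      · simp
      · intro x hx
        have : x ≤ i.succ ↔ x ≤ i.castSucc := by
          simp only [Fin.le_def, Fin.ext_iff, Fin.val_succ, Fin.val_castSucc, ne_eq] at *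
          omega
        simp [this]
    have hsub : ∀ i : Fin l, i.succ - 1 = i.castSucc := by
      intro i
      rw [sub_eq_iff_eq_add]; simp
    have hE : ∀ i, E i - E (i - 1) = d i := by
      intro i
      refine Fin.cases ?_ (fun i => ?_) i
      · have : (0 - 1 : Fin (l + 1)) = Fin.last l := by
          rw [sub_eq_iff_eq_add]; simp
        rw [this, hElast, hE0, sub_zero]
      · rw [hsub, hEsucc]
    rw [Fintype.sum_eq_single E]
    · have hG : G E = 1 := by
        refine prod_eq_one fun i _ => ?_
        by_cases hi : i = Fin.last l
        · simp [δ, hi, hElast]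
        · simp [δ, hi]
      rw [hG, one_mul]
      refine prod_congr rfl fun t _ => ?_
      rw [prod_eq_one, one_mul]
      · refine sum_congr rfl fun x _ => ?_
        congr 1
        simp only [E]
        rw [← Equiv.sum_comp τ.symm, Fintype.sum_prod_type]
        refine sum_congr rfl fun t' _ => sum_congr rfl fun y _ => ?_
        simp only [d, Equiv.apply_symm_apply]
        split_ifs <;> rfl
      · intro j _
        simp [hE, d]
    · intro ε hε
      by_contra hne
      refine hε ?_
      obtain ⟨hG, hP⟩ := ne_zero_and_ne_zero_of_mul hne
      have hlast : ε (Fin.last l) = 0 := by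
        have := (prod_ne_zero_iff.1 hG) (Fin.last l) (mem_univ _)
        have h' : ε (Fin.last l) ≠ 1 := by
          intro h
          simp [δ, h] at this
        revert h'
        generalize ε (Fin.last l) = z
        decide +revert
      have hd : ∀ i, ε i - ε (i - 1) = d i := by
        intro i
        have h1 := prod_ne_zero_iff.1 hP (τ i).1 (mem_univ _)
        have h2 := prod_ne_zero_iff.1 (left_ne_zero_of_mul h1) (τ i).2 (mem_univ _)
        by_contra h
        simp [d] at h h2
        exact h h2
      ext i : 1
      induction i using Fin.induction with
      | zero =>
        have := hd 0
        have h0 : (0 - 1 : Fin (l + 1)) = Fin.last l := by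
          rw [sub_eq_iff_eq_add]; simp
        rw [h0, hlast, sub_zero] at this
        rw [this, hE0]
      | succ i ih =>
        have h1 := hd i.succ
        have h2 := hE i.succ
        rw [hsub] at h1 h2
        rw [ih] at h1
        linear_combination h1 - h2
  rw [hone, map_one] at hzero
  exact absurd hzero (by decide)

/-- The graph formed by a path and vertex-disjoint triangles is `3`-colorable. -/
theorem exists_rainbow_three_coloring {ι : Type*} [Fintype ι] (p : ι × Fin 3 → ℕ)
    (hp : Function.Injective p) :
    ∃ c : ι → Fin 3 → Fin 3, (∀ t, Function.Injective (c t)) ∧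
      ∀ v w, p w = p v + 1 → c v.1 v.2 ≠ c w.1 w.2 := by
  classical
  rcases isEmpty_or_nonempty ι with _ | _
  · exact ⟨fun t => isEmptyElim t, fun t => isEmptyElim t, fun v => isEmptyElim v.1⟩
  obtain ⟨l, hl⟩ : ∃ l, Fintype.card (ι × Fin 3) = l + 1 :=
    Nat.exists_eq_succ_of_ne_zero Fintype.card_ne_zero
  let _ : LinearOrder (ι × Fin 3) := LinearOrder.lift' p hp
  have hlt : ∀ v w : ι × Fin 3, v < w ↔ p v < p w := fun v w => Iff.rfl
  let τ := Fintype.orderIsoFinOfCardEq (ι × Fin 3) hl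
  obtain ⟨π, hπ⟩ := exists_rainbow_coloring_fin_s17 τ.toEquiv
  refine ⟨fun t => π t, fun t => (π t).injective, fun v w hvw => ?_⟩
  have hvw' : τ.symm v < τ.symm w := by
    rw [OrderIso.lt_iff_lt, hlt]; omega
  have hne : τ.symm v ≠ Fin.last l := (hvw'.trans_le (Fin.le_last _)).ne
  have hsucc : τ.symm v + 1 = τ.symm w := by
    have hv1 := Fin.val_add_one_of_lt (hvw'.trans_le (Fin.le_last _))
    by_contra hcon
    have h1 : τ.symm v + 1 < τ.symm w := by
      refine lt_of_le_of_ne ?_ hcon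
      rw [Fin.le_def, hv1]; exact hvw'
    have h2 : τ.symm v < τ.symm v + 1 := by
      rw [Fin.lt_def, hv1]; exact Nat.lt_succ_self _
    rw [← τ.lt_iff_lt, OrderIso.apply_symm_apply, hlt] at h1 h2
    omega
  have := hπ (τ.symm v) hne
  rw [hsucc] at this
  simpa using this

/-- For `3 ≤ n`, the graph formed by a path and vertex-disjoint cliques on `n` vertices is
`n`-colorable. -/
theorem exists_rainbow_coloring_s17 {ι : Type*} [Fintype ι] (n : ℕ) (hn : 3 ≤ n)
    (p : ι × Fin n → ℕ) (hp : Function.Injective p) :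
    ∃ c : ι → Fin n → Fin n, (∀ t, Function.Injective (c t)) ∧
      ∀ v w, p w = p v + 1 → c v.1 v.2 ≠ c w.1 w.2 := by
  induction n, hn using Nat.le_induction with
  | base => exact exists_rainbow_three_coloring p hp
  | succ n hn ih =>
    obtain ⟨c, hc, hcp⟩ := ih (fun v => p (v.1, v.2.castSucc)) fun v w h => by
      have := hp h
      aesop
    have : NeZero n := ⟨by omega⟩
    choose s hs using fun t => (Finite.surjective_of_injective (hc t)) 0
    obtain ⟨c', hc', hcp'⟩ := ih (fun v => p (v.1, (s v.1).castSucc.succAbove v.2)) fun v w h => by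
      have := hp h
      rw [Prod.mk.injEq] at this
      obtain ⟨h1, h2⟩ := this
      rw [h1] at h2
      exact Prod.ext h1 (Fin.succAbove_right_injective h2)
    refine ⟨fun t => (s t).castSucc.insertNth (Fin.last n) fun j => (c' t j).castSucc,
      fun t => ?_, ?_⟩
    · rw [Function.Injective, Fin.forall_iff_succAbove (s t).castSucc]
      refine ⟨?_, fun i => ?_⟩
      · rw [Fin.forall_iff_succAbove (s t).castSucc]
        simp [(Fin.castSucc_ne_last _).symm]
      · rw [Fin.forall_iff_succAbove (s t).castSucc]
        simp [Fin.castSucc_ne_last, (hc' t).eq_iff]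
    · rintro ⟨t, i⟩ ⟨t', i'⟩
      revert i i'
      rw [Fin.forall_iff_succAbove (s t).castSucc]
      refine ⟨?_, fun i => ?_⟩
      · rw [Fin.forall_iff_succAbove (s t').castSucc]
        refine ⟨fun h => absurd ((hs t).trans (hs t').symm) (hcp (t, s t) (t', s t') h), ?_⟩
        simp [(Fin.castSucc_ne_last _).symm]
      · rw [Fin.forall_iff_succAbove (s t').castSucc]
        refine ⟨by simp [Fin.castSucc_ne_last], fun i' h => ?_⟩
        simpa using hcp' (t, i) (t', i') h

theorem sum_le_sum_of_injOn_of_nonneg {α β M : Type*} [AddCommMonoid M] [PartialOrder M]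
    [IsOrderedAddMonoid M] {s : Finset α} {t : Finset β} {f : α → M} {g : β → M} (φ : α → β)
    (hφ : ∀ x ∈ s, φ x ∈ t) (hinj : Set.InjOn φ s) (hle : ∀ x ∈ s, f x ≤ g (φ x))
    (hg : ∀ y ∈ t, 0 ≤ g y) : ∑ x ∈ s, f x ≤ ∑ y ∈ t, g y := by
  classical
  calc ∑ x ∈ s, f x ≤ ∑ x ∈ s, g (φ x) := sum_le_sum hle
    _ = ∑ y ∈ s.image φ, g y := (sum_image hinj).symm
    _ ≤ ∑ y ∈ t, g y := sum_le_sum_of_subset_of_nonneg (image_subset_iff.2 hφ) fun y hy _ => hg y hy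

/-- For nonnegative item values, coloring the items so that the `k`-th group of `n` items in order of
decreasing value is rainbow gives an allocation that is envy-free up to one item of the envied
agent. -/
theorem exists_allocation_of_nonneg (n m : ℕ) (hn : 3 ≤ n) (u : Fin m → ℝ) (hu : ∀ o, 0 ≤ u o) :
    ∃ A : Fin n → Finset (Fin m),
      (∀ i j, i ≠ j → Disjoint (A i) (A j)) ∧
      (∀ i, ∀ x ∈ A i, ∀ y ∈ A i, ¬ (x.val + 1 = y.val ∨ y.val + 1 = x.val)) ∧
      (∀ o, ∃ i, o ∈ A i) ∧
      (∀ i j, ∃ S ⊆ A j, S.card ≤ 1 ∧ ∑ o ∈ A j \ S, u o ≤ ∑ o ∈ A i, u o) := by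
  have hn0 : 0 < n := by omega
  let σ := Tuple.sort fun o => - u o
  have hσ : ∀ a b : Fin m, a ≤ b → u (σ b) ≤ u (σ a) := fun a b h => by
    simpa using Tuple.monotone_sort (fun o => - u o) h
  let g : ℕ → ℕ := fun t => if h : t < m then σ ⟨t, h⟩ else t
  have hg : Function.Injective g := by
    intro a b h
    simp only [g] at h
    split_ifs at h with h1 h2 h2
    · simpa using σ.injective (Fin.ext h)
    · have := (σ ⟨a, h1⟩).isLt; omega
    · have := (σ ⟨b, h2⟩).isLt; omega
    · exact h
  have hgσ : ∀ a : Fin m, g a = σ a := fun a => by simp [g]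
  have hidx : Function.Injective fun v : Fin m × Fin n => n * v.1.val + v.2.val := by
    rintro ⟨a, b⟩ ⟨a', b'⟩ h
    simp only at h
    have h1 := congrArg (· / n) h
    simp only [Nat.mul_add_div hn0, Nat.div_eq_of_lt b.isLt, Nat.div_eq_of_lt b'.isLt] at h1
    have h2 : a = a' := Fin.ext (by simpa using h1)
    subst h2
    simpa [Fin.ext_iff] using h
  obtain ⟨c, hc, hcp⟩ := exists_rainbow_coloring_s17 n hn _ (hg.comp hidx)
  let r : Fin m → Fin m := σ.symm
  let blk : Fin m → Fin m := fun o => ⟨(r o).val / n, (Nat.div_le_self _ _).trans_lt (r o).isLt⟩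
  let off : Fin m → Fin n := fun o => ⟨(r o).val % n, Nat.mod_lt _ hn0⟩
  let C : Fin m → Fin n := fun o => c (blk o) (off o)
  have hp : ∀ o, g (n * (blk o).val + (off o).val) = o.val := fun o => by
    simp only [blk, off, Nat.div_add_mod]
    rw [hgσ]; simp [r]
  have hCadj : ∀ x y : Fin m, y.val = x.val + 1 → C x ≠ C y := fun x y h =>
    hcp (blk x, off x) (blk y, off y) (by simp only [Function.comp_apply, hp, h])
  have hr : ∀ o, (r o).val = n * (blk o).val + (off o).val := fun o =>
    (Nat.div_add_mod _ _).symm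
  have hCinj : ∀ x y, C x = C y → blk x = blk y → x = y := by
    intro x y h hb
    simp only [C, hb] at h
    have ho := hc _ h
    apply Fin.ext
    rw [← hp x, ← hp y, hb, ho]
  refine ⟨fun i => univ.filter fun o => C o = i, ?_, ?_, fun o => ⟨C o, by simp⟩, ?_⟩
  · intro i j hij
    rw [disjoint_filter]
    rintro o _ rfl
    exact hij
  · intro i x hx y hy h
    simp only [mem_filter, mem_univ, true_and] at hx hy
    rcases h with h | h
    · exact hCadj x y h.symm (hx.trans hy.symm)
    · exact hCadj y x h.symm (hy.trans hx.symm)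
  · intro i j
    refine ⟨univ.filter fun o => C o = j ∧ (blk o).val = 0, ?_, ?_, ?_⟩
    · exact fun o => by simp +contextual
    · rw [card_le_one]
      intro x hx y hy
      simp only [mem_filter, mem_univ, true_and] at hx hy
      exact hCinj x y (hx.1.trans hy.1.symm) (Fin.ext (hx.2.trans hy.2.symm))
    · have hprev : ∀ x, (blk x).val ≠ 0 → ∃ y, C y = i ∧ (blk y).val + 1 = (blk x).val := by
        intro x hx
        let b : Fin m := ⟨(blk x).val - 1, (Nat.sub_le _ _).trans_lt (blk x).isLt⟩
        obtain ⟨q, hq⟩ := Finite.surjective_of_injective (hc b) i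
        have hlt : n * b.val + q.val < (r x).val := by
          have h1 := hr x
          have h2 : (blk x).val = b.val + 1 := by simp only [b]; omega
          rw [h2, mul_add] at h1
          have := q.isLt
          omega
        let y := σ ⟨n * b.val + q.val, hlt.trans (r x).isLt⟩
        have hby : blk y = b := by
          apply Fin.ext
          simp [blk, r, y, Nat.mul_add_div hn0, Nat.div_eq_of_lt q.isLt]
        have hoy : off y = q := by
          apply Fin.ext
          simp [off, r, y, Nat.mod_eq_of_lt q.isLt]
        refine ⟨y, by simp only [C, hby, hoy, hq], ?_⟩
        rw [hby]; simp only [b]; omega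
      choose! φ hφ using hprev
      refine sum_le_sum_of_injOn_of_nonneg φ ?_ ?_ ?_ fun y _ => hu y
      · intro x hx
        simp only [mem_sdiff, mem_filter, mem_univ, true_and, not_and] at hx ⊢
        exact (hφ x (hx.2 hx.1)).1
      · intro x hx y hy hxy
        simp only [coe_sdiff, Set.mem_sdiff, mem_coe, mem_filter, mem_univ, true_and, not_and]
          at hx hy
        refine hCinj x y (hx.1.trans hy.1.symm) (Fin.ext ?_)
        rw [← (hφ x (hx.2 hx.1)).2, ← (hφ y (hy.2 hy.1)).2, hxy]
      · intro x hx
        simp only [mem_sdiff, mem_filter, mem_univ, true_and, not_and] at hx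
        have h1 := (hφ x (hx.2 hx.1)).2
        have h2 : r (φ x) ≤ r x := by
          rw [Fin.le_def, hr, hr, ← h1, mul_add]
          have := (off (φ x)).isLt
          omega
        simpa [r] using hσ _ _ h2

end

/-- for n ≥ 3 agents with an identical additive monotone valuation (all item
values nonnegative, or all nonpositive) on a path graph, a complete (hence maximal) EF1
allocation exists. -/
theorem stmt_17 (n m : ℕ) (hn : 3 ≤ n) (w : Fin m → ℝ)
    (hmono : (∀ o : Fin m, 0 ≤ w o) ∨ (∀ o : Fin m, w o ≤ 0)) :
    ∃ A : Fin n → Finset (Fin m),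
      (∀ i j : Fin n, i ≠ j → Disjoint (A i) (A j)) ∧
      (∀ i : Fin n, ∀ x ∈ A i, ∀ y ∈ A i, ¬ (x.val + 1 = y.val ∨ y.val + 1 = x.val)) ∧
      (∀ o : Fin m, ∃ i : Fin n, o ∈ A i) ∧
      (∀ i j : Fin n, ∃ S : Finset (Fin m), S ⊆ A i ∪ A j ∧ S.card ≤ 1 ∧
        (∑ o ∈ A i \ S, w o) ≥ (∑ o ∈ A j \ S, w o)) := by
  rcases hmono with hw | hw
  · obtain ⟨A, hdisj, hind, hcompl, hef⟩ := exists_allocation_of_nonneg n m hn w hw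
    refine ⟨A, hdisj, hind, hcompl, fun i j => ?_⟩
    rcases eq_or_ne i j with rfl | hij
    · exact ⟨∅, by simp, by simp, le_rfl⟩
    · obtain ⟨S, hS, hcard, hle⟩ := hef i j
      refine ⟨S, hS.trans Finset.subset_union_right, hcard, ?_⟩
      rwa [Finset.sdiff_eq_self_of_disjoint ((hdisj i j hij).mono_right hS)]
  · obtain ⟨A, hdisj, hind, hcompl, hef⟩ :=
      exists_allocation_of_nonneg n m hn (fun o => - w o) fun o => neg_nonneg.2 (hw o)
    refine ⟨A, hdisj, hind, hcompl, fun i j => ?_⟩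
    rcases eq_or_ne i j with rfl | hij
    · exact ⟨∅, by simp, by simp, le_rfl⟩
    · obtain ⟨S, hS, hcard, hle⟩ := hef j i
      refine ⟨S, hS.trans Finset.subset_union_left, hcard, ?_⟩
      rw [Finset.sdiff_eq_self_of_disjoint ((hdisj j i hij.symm).mono_right hS)]
      simpa using hle
end
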